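/- arXiv:1902.08272 — 3 statements merged into one kernel-verified Lean document; each statement's English description precedes it below -/
import Mathlib

section
/- Let f : {0,1}* → {0,1}* be any computable function. Then there exists a computable function g : {0,1}* → ℕ such that the language L = { f(x)·$^ℓ·x : x ∈ {0,1}*, ℓ ≥ g(x) } over the alphabet {0,1,$} is recognised by some total parsing expression grammar; that is, L ∈ PEG. -/
/-! ## Parsing expression grammars -/

/-- Parsing expressions over terminal alphabet `α` and non-terminal alphabet `ν`. -/
inductive PExp (α : Type) (ν : Type) : Type where
  | eps : PExp α ν
  | fail : PExp α ν
  | term (a : α) : PExp α ν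
  | nt (A : ν) : PExp α ν
  | notP (e : PExp α ν) : PExp α ν
  | andP (e : PExp α ν) : PExp α ν
  | seq (e₁ e₂ : PExp α ν) : PExp α ν
  | choice (e₁ e₂ : PExp α ν) : PExp α ν

/-- Big-step semantics of the recognition map `Rec` of a PEG with rules `R`:
`PegRec R e x r` holds iff `Rec(e,x)` is defined and equals `r`, where
`r = none` codes `FAIL` and `r = some y` codes the consumed prefix `y` of `x`. -/
inductive PegRec {α ν : Type} (R : ν → PExp α ν) :
    PExp α ν → List α → Option (List α) → Prop where
  | eps (x : List α) : PegRec R .eps x (some [])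
  | fail (x : List α) : PegRec R .fail x none
  | termOk (a : α) (z : List α) : PegRec R (.term a) (a :: z) (some [a])
  | termMismatch (a b : α) (z : List α) (h : a ≠ b) : PegRec R (.term a) (b :: z) none
  | termNil (a : α) : PegRec R (.term a) [] none
  | notFail (e : PExp α ν) (x : List α) :
      PegRec R e x none → PegRec R (.notP e) x (some [])
  | notSucc (e : PExp α ν) (x y : List α) :
      PegRec R e x (some y) → PegRec R (.notP e) x none
  | andSucc (e : PExp α ν) (x y : List α) :
      PegRec R e x (some y) → PegRec R (.andP e) x (some [])
  | andFail (e : PExp α ν) (x : List α) :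
      PegRec R e x none → PegRec R (.andP e) x none
  | seqOk (e₁ e₂ : PExp α ν) (y₁ z y₂ : List α) :
      PegRec R e₁ (y₁ ++ z) (some y₁) → PegRec R e₂ z (some y₂) →
      PegRec R (.seq e₁ e₂) (y₁ ++ z) (some (y₁ ++ y₂))
  | seqFail₁ (e₁ e₂ : PExp α ν) (x : List α) :
      PegRec R e₁ x none → PegRec R (.seq e₁ e₂) x none
  | seqFail₂ (e₁ e₂ : PExp α ν) (y₁ z : List α) :
      PegRec R e₁ (y₁ ++ z) (some y₁) → PegRec R e₂ z none →
      PegRec R (.seq e₁ e₂) (y₁ ++ z) none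
  | choice₁ (e₁ e₂ : PExp α ν) (x y : List α) :
      PegRec R e₁ x (some y) → PegRec R (.choice e₁ e₂) x (some y)
  | choice₂ (e₁ e₂ : PExp α ν) (x : List α) (r : Option (List α)) :
      PegRec R e₁ x none → PegRec R e₂ x r → PegRec R (.choice e₁ e₂) x r
  | ntRule (A : ν) (x : List α) (r : Option (List α)) :
      PegRec R (R A) x r → PegRec R (.nt A) x r

/-- A parsing expression grammar over the (finite) terminal alphabet `α`:
a finite alphabet `ν` of non-terminals, a rule for each non-terminal,
and a starting non-terminal. -/
structure PEG (α : Type) : Type 1 where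
  ν : Type
  finNT : Finite ν
  R : ν → PExp α ν
  S : ν

/-- A PEG is total if its recognition map is total (defined on every expression and input). -/
def PEG.Total {α : Type} (G : PEG α) : Prop :=
  ∀ (e : PExp α G.ν) (x : List α), ∃ r, PegRec G.R e x r

/-- The language recognised by a PEG: strings on which the starting
non-terminal succeeds and consumes the whole input. -/
def PEG.Lang {α : Type} (G : PEG α) : Set (List α) :=
  { x | PegRec G.R (.nt G.S) x (some x) }

/-- A language is in the class `PEG` iff some total parsing expression grammar recognises it. -/
def IsPEGLang {α : Type} (L : Set (List α)) : Prop :=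
  ∃ G : PEG α, G.Total ∧ G.Lang = L

/-- The three-symbol alphabet `{0, 1, $}`. -/
inductive DSym : Type where
  | b0 : DSym
  | b1 : DSym
  | dollar : DSym
  deriving DecidableEq

/-- A binary string viewed as a string over `{0, 1, $}`. -/
def boolToDSym (w : List Bool) : List DSym :=
  w.map (fun b => if b then DSym.b1 else DSym.b0)

theorem PegRec.unique {α ν : Type} {R : ν → PExp α ν} {e : PExp α ν} {x : List α}
    {r r' : Option (List α)} (h : PegRec R e x r) (h' : PegRec R e x r') : r = r' := by
  induction h generalizing r' with
  | eps x => cases h'; rfl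
  | fail x => cases h'; rfl
  | termOk a z => cases h' <;> first | rfl | contradiction
  | termMismatch a b z h => cases h' <;> first | rfl | contradiction
  | termNil a => cases h'; rfl
  | notFail e x _ ih => cases h' with
    | notFail => rfl
    | notSucc _ _ y h => exact absurd (ih h) (by simp)
  | notSucc e x y _ ih => cases h' with
    | notFail _ _ h => exact absurd (ih h) (by simp)
    | notSucc => rfl
  | andSucc e x y _ ih => cases h' with
    | andFail _ _ h => exact absurd (ih h) (by simp)
    | andSucc => rfl
  | andFail e x _ ih => cases h' with
    | andFail => rfl
    | andSucc _ _ y h => exact absurd (ih h) (by simp)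
  | seqOk e₁ e₂ y₁ z y₂ _ _ ih₁ ih₂ =>
    generalize hw : y₁ ++ z = w at h'
    cases h' with
    | seqOk _ _ y₁' z' y₂' h₁ h₂ =>
      obtain rfl : y₁ = y₁' := Option.some.inj (ih₁ (hw ▸ h₁))
      obtain rfl : z = z' := by simpa using hw
      simpa using ih₂ h₂
    | seqFail₁ _ _ _ h => exact absurd (ih₁ (hw ▸ h)) (by simp)
    | seqFail₂ _ _ y₁' z' h₁ h₂ =>
      obtain rfl : y₁ = y₁' := Option.some.inj (ih₁ (hw ▸ h₁))
      obtain rfl : z = z' := by simpa using hw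
      simpa using ih₂ h₂
  | seqFail₁ e₁ e₂ x _ ih => cases h' with
    | seqOk _ _ y₁ z y₂ h => exact absurd (ih h) (by simp)
    | seqFail₁ => rfl
    | seqFail₂ => rfl
  | seqFail₂ e₁ e₂ y₁ z _ _ ih₁ ih₂ =>
    generalize hw : y₁ ++ z = w at h'
    cases h' with
    | seqOk _ _ y₁' z' y₂' h₁ h₂ =>
      obtain rfl : y₁ = y₁' := Option.some.inj (ih₁ (hw ▸ h₁))
      obtain rfl : z = z' := by simpa using hw
      simpa using ih₂ h₂
    | seqFail₁ _ _ _ h => rfl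
    | seqFail₂ _ _ y₁' z' h₁ h₂ => rfl
  | choice₁ e₁ e₂ x y _ ih => cases h' with
    | choice₁ _ _ _ y' h => exact ih h
    | choice₂ _ _ _ _ h => exact absurd (ih h) (by simp)
  | choice₂ e₁ e₂ x r _ _ ih₁ ih₂ => cases h' with
    | choice₁ _ _ _ y' h => exact absurd (ih₁ h) (by simp)
    | choice₂ _ _ _ _ _ h => exact ih₂ h
  | ntRule A x r _ ih => cases h' with
    | ntRule _ _ _ h => exact ih h

namespace PExp

variable {α ν : Type}

/-- The suffix left over by an expression when `ρ` interprets the non-terminals. -/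
def den [DecidableEq α] (ρ : ν → List α → Option (List α)) :
    PExp α ν → List α → Option (List α)
  | .eps, x => some x
  | .fail, _ => none
  | .term _, [] => none
  | .term a, b :: z => if a = b then some z else none
  | .nt A, x => ρ A x
  | .notP e, x => if den ρ e x = none then some x else none
  | .andP e, x => if den ρ e x = none then none else some x
  | .seq e₁ e₂, x => (den ρ e₁ x).bind (den ρ e₂)
  | .choice e₁ e₂, x => (den ρ e₁ x).or (den ρ e₂ x)

/-- Non-terminals are only called after a terminal has been read. -/
inductive Guarded : PExp α ν → Prop
  | eps : Guarded .eps
  | fail : Guarded .fail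
  | term (a : α) : Guarded (.term a)
  | notP {e : PExp α ν} : Guarded e → Guarded (.notP e)
  | andP {e : PExp α ν} : Guarded e → Guarded (.andP e)
  | seq {e₁ e₂ : PExp α ν} : Guarded e₁ → Guarded e₂ → Guarded (.seq e₁ e₂)
  | termSeq (a : α) (e : PExp α ν) : Guarded (.seq (.term a) e)
  | choice {e₁ e₂ : PExp α ν} : Guarded e₁ → Guarded e₂ → Guarded (.choice e₁ e₂)

/-- Replace every non-terminal by its rule. -/
def inline (R : ν → PExp α ν) : PExp α ν → PExp α ν
  | .nt A => R A
  | .notP e => .notP (inline R e)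
  | .andP e => .andP (inline R e)
  | .seq e₁ e₂ => .seq (inline R e₁) (inline R e₂)
  | .choice e₁ e₂ => .choice (inline R e₁) (inline R e₂)
  | e => e

theorem guarded_inline {R : ν → PExp α ν} (h : ∀ A, (R A).Guarded) (e : PExp α ν) :
    (inline R e).Guarded := by
  induction e with
  | eps => exact .eps
  | fail => exact .fail
  | term a => exact .term a
  | nt A => exact h A
  | notP e ih => exact .notP ih
  | andP e ih => exact .andP ih
  | seq e₁ e₂ ih₁ ih₂ => exact .seq ih₁ ih₂
  | choice e₁ e₂ ih₁ ih₂ => exact .choice ih₁ ih₂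

theorem den_inline [DecidableEq α] {ρ ρ' : ν → List α → Option (List α)} {R : ν → PExp α ν}
    (h : ∀ A x, den ρ (R A) x = ρ' A x) (e : PExp α ν) (x : List α) :
    den ρ (inline R e) x = den ρ' e x := by
  induction e generalizing x with
  | nt A => exact h A x
  | notP e ih => simp [inline, den, ih]
  | andP e ih => simp [inline, den, ih]
  | seq e₁ e₂ ih₁ ih₂ =>
    have : den ρ (inline R e₂) = den ρ' e₂ := funext ih₂
    simp [inline, den, ih₁, this]
  | choice e₁ e₂ ih₁ ih₂ => simp [inline, den, ih₁, ih₂]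
  | eps => rfl
  | fail => rfl
  | term a => cases x <;> rfl

/-- Prioritized choice over a list of expressions. -/
def choices : List (PExp α ν) → PExp α ν
  | [] => .fail
  | e :: l => .choice e (choices l)

theorem guarded_choices {l : List (PExp α ν)} (h : ∀ e ∈ l, e.Guarded) :
    (choices l).Guarded := by
  induction l with
  | nil => exact .fail
  | cons e l ih =>
    exact .choice (h e (by simp)) (ih fun e he => h e (by simp [he]))

open Classical in
theorem den_choices [DecidableEq α] {ρ : ν → List α → Option (List α)}
    {l : List (PExp α ν)} {x z : List α}
    (h : ∀ e ∈ l, den ρ e x = none ∨ den ρ e x = some z) :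
    den ρ (choices l) x = if ∃ e ∈ l, den ρ e x = some z then some z else none := by
  induction l with
  | nil => simp [choices, den]
  | cons e l ih =>
    have ih := ih fun e he => h e (by simp [he])
    rcases h e (by simp) with he | he <;> simp [choices, den, he, ih]

/-- The recognition map on `e` and `x` is defined and leaves over the suffix described by the
last argument (`none` being failure). -/
def Leaves (R : ν → PExp α ν) (e : PExp α ν) (x : List α) : Option (List α) → Prop
  | none => PegRec R e x none
  | some z => ∃ y, x = y ++ z ∧ PegRec R e x (some y)

variable {R : ν → PExp α ν}

theorem leaves_term [DecidableEq α] (ρ : ν → List α → Option (List α)) (a : α) (x : List α) :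
    Leaves R (.term a) x (den ρ (.term a) x) := by
  cases x with
  | nil => exact .termNil a
  | cons b z =>
    by_cases h : a = b
    · subst h
      simp only [den, if_true]
      exact ⟨[a], rfl, .termOk a z⟩
    · simp only [den, h, if_false]
      exact .termMismatch a b z h

theorem Leaves.notP [DecidableEq α] {ρ : ν → List α → Option (List α)} {e : PExp α ν}
    {x : List α} (h : Leaves R e x (den ρ e x)) :
    Leaves R (.notP e) x (den ρ (.notP e) x) := by
  unfold den
  cases hd : den ρ e x with
  | none => rw [hd] at h; exact ⟨[], rfl, .notFail _ _ h⟩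
  | some z => rw [hd] at h; obtain ⟨y, -, hy⟩ := h; exact .notSucc _ _ _ hy

theorem Leaves.andP [DecidableEq α] {ρ : ν → List α → Option (List α)} {e : PExp α ν}
    {x : List α} (h : Leaves R e x (den ρ e x)) :
    Leaves R (.andP e) x (den ρ (.andP e) x) := by
  unfold den
  cases hd : den ρ e x with
  | none => rw [hd] at h; exact .andFail _ _ h
  | some z => rw [hd] at h; obtain ⟨y, -, hy⟩ := h; exact ⟨[], rfl, .andSucc _ _ _ hy⟩

theorem Leaves.choice [DecidableEq α] {ρ : ν → List α → Option (List α)} {e₁ e₂ : PExp α ν}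
    {x : List α} (h₁ : Leaves R e₁ x (den ρ e₁ x)) (h₂ : Leaves R e₂ x (den ρ e₂ x)) :
    Leaves R (.choice e₁ e₂) x (den ρ (.choice e₁ e₂) x) := by
  unfold den
  cases hd : den ρ e₁ x with
  | none =>
    rw [hd] at h₁
    rw [Option.none_or]
    cases hd₂ : den ρ e₂ x with
    | none => rw [hd₂] at h₂; exact .choice₂ _ _ _ _ h₁ h₂
    | some z => rw [hd₂] at h₂; obtain ⟨y, hx, hy⟩ := h₂; exact ⟨y, hx, .choice₂ _ _ _ _ h₁ hy⟩
  | some z => rw [hd] at h₁; obtain ⟨y, hx, hy⟩ := h₁; exact ⟨y, hx, .choice₁ _ _ _ _ hy⟩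

theorem Leaves.seq [DecidableEq α] {ρ : ν → List α → Option (List α)} {e₁ e₂ : PExp α ν}
    {x : List α} (h₁ : Leaves R e₁ x (den ρ e₁ x))
    (h₂ : ∀ z, den ρ e₁ x = some z → z.length ≤ x.length → Leaves R e₂ z (den ρ e₂ z)) :
    Leaves R (.seq e₁ e₂) x (den ρ (.seq e₁ e₂) x) := by
  unfold den
  cases hd : den ρ e₁ x with
  | none => rw [hd] at h₁; exact .seqFail₁ _ _ _ h₁
  | some z =>
    rw [hd] at h₁
    obtain ⟨y, rfl, hy⟩ := h₁
    have h₂ := h₂ z hd (by simp)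
    rw [Option.bind_some]
    cases hd₂ : den ρ e₂ z with
    | none => rw [hd₂] at h₂; exact .seqFail₂ _ _ _ _ hy h₂
    | some w =>
      rw [hd₂] at h₂
      obtain ⟨y', rfl, hy'⟩ := h₂
      exact ⟨y ++ y', by simp, .seqOk _ _ _ _ _ hy hy'⟩

theorem leaves_den [DecidableEq α] {ρ : ν → List α → Option (List α)} {n : ℕ}
    (h : ∀ A (x : List α), x.length ≤ n → Leaves R (.nt A) x (ρ A x)) (e : PExp α ν)
    (x : List α) (hx : x.length ≤ n) : Leaves R e x (den ρ e x) := by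
  induction e generalizing x with
  | eps => exact ⟨[], rfl, .eps x⟩
  | fail => exact .fail x
  | term a => exact leaves_term ρ a x
  | nt A => exact h A x hx
  | notP e ih => exact (ih x hx).notP
  | andP e ih => exact (ih x hx).andP
  | seq e₁ e₂ ih₁ ih₂ => exact (ih₁ x hx).seq fun z _ hz => ih₂ z (hz.trans hx)
  | choice e₁ e₂ ih₁ ih₂ => exact (ih₁ x hx).choice (ih₂ x hx)

theorem Guarded.leaves_den [DecidableEq α] {ρ : ν → List α → Option (List α)} {n : ℕ}
    (h : ∀ A (x : List α), x.length < n → Leaves R (.nt A) x (ρ A x)) {e : PExp α ν}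
    (he : e.Guarded) (x : List α) (hx : x.length ≤ n) : Leaves R e x (den ρ e x) := by
  induction he generalizing x with
  | eps => exact ⟨[], rfl, .eps x⟩
  | fail => exact .fail x
  | term a => exact leaves_term ρ a x
  | notP _ ih => exact (ih x hx).notP
  | andP _ ih => exact (ih x hx).andP
  | seq _ _ ih₁ ih₂ => exact (ih₁ x hx).seq fun z _ hz => ih₂ z (hz.trans hx)
  | choice _ _ ih₁ ih₂ => exact (ih₁ x hx).choice (ih₂ x hx)
  | termSeq a e =>
    refine (leaves_term ρ a x).seq fun z hz _ => ?_
    have hlt : z.length < x.length := by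
      cases x with
      | nil => simp [den] at hz
      | cons b w =>
        obtain ⟨-, rfl⟩ : a = b ∧ w = z := by simpa [den] using hz
        simp
    exact PExp.leaves_den (n := z.length)
      (fun A y hy => h A y (by omega)) e z le_rfl

/-- A guarded grammar computes any interpretation of the non-terminals that satisfies its rules. -/
theorem leaves_of_guarded [DecidableEq α] {ρ : ν → List α → Option (List α)}
    (hg : ∀ A, (R A).Guarded) (hρ : ∀ A x, den ρ (R A) x = ρ A x) (e : PExp α ν) (x : List α) :
    Leaves R e x (den ρ e x) := by
  have key : ∀ n A (x : List α), x.length ≤ n → Leaves R (.nt A) x (ρ A x) := by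
    intro n
    induction n using Nat.strong_induction_on with
    | _ n ih =>
      intro A x hx
      have hd := (hg A).leaves_den (ρ := ρ) (n := n)
        (fun B y hy => ih y.length hy B y le_rfl) x hx
      rw [hρ] at hd
      cases hr : ρ A x with
      | none => rw [hr] at hd; exact .ntRule _ _ _ hd
      | some z => rw [hr] at hd; obtain ⟨y, h, hy⟩ := hd; exact ⟨y, h, .ntRule _ _ _ hy⟩
  exact leaves_den (key x.length) e x le_rfl

end PExp

instance : Fintype DSym where
  elems := {.b0, .b1, .dollar}
  complete a := by cases a <;> decide

/-- The action of a stack automaton on the stack it has inspected. -/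
inductive StackAct (Γ : Type) : Type where
  | keep : StackAct Γ
  | pop : StackAct Γ
  | push (a : Γ) : StackAct Γ

namespace StackAct

variable {Γ Δ : Type}

def app : StackAct Γ → List Γ → List Γ
  | keep, l => l
  | pop, l => l.tail
  | push a, l => a :: l

def map (f : Γ → Δ) : StackAct Γ → StackAct Δ
  | keep => keep
  | pop => pop
  | push a => push (f a)

theorem map_app (f : Γ → Δ) (u : StackAct Γ) (l : List Γ) :
    (u.app l).map f = (u.map f).app (l.map f) := by
  cases u <;> simp [app, map, List.map_tail]

theorem map_map_snd {β : Type} (t : β) (u : StackAct Γ) :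
    (u.map fun a => (t, a)).map Prod.snd = u := by
  cases u <;> rfl

end StackAct

/-- A deterministic automaton with stacks `K` that reads its input from right to left. In state `q`
it inspects the stack `κ q`; the symbol read and the top of that stack determine the next state
and the action on that stack. -/
structure StackAut (K Γ Q : Type) where
  κ : Q → K
  δ : Q → DSym → Option Γ → Q × StackAct Γ
  start : Q

namespace StackAut

variable {K Γ Q : Type} (M : StackAut K Γ Q)

/-- The non-terminals of the grammar simulating a stack automaton. -/
inductive NT (K Γ Q : Type) : Type where
  | state (q : Q) : NT K Γ Q
  | stack (k : K) : NT K Γ Q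
  | pushed (a : Γ) : NT K Γ Q
  | rest : NT K Γ Q
  | accept : NT K Γ Q

instance [Finite K] [Finite Γ] [Finite Q] : Finite (NT K Γ Q) :=
  Finite.of_injective (β := (Q ⊕ K) ⊕ (Γ ⊕ Bool))
    (fun
      | .state q => .inl (.inl q)
      | .stack k => .inl (.inr k)
      | .pushed a => .inr (.inl a)
      | .rest => .inr (.inr true)
      | .accept => .inr (.inr false))
    (by rintro (_ | _ | _ | _ | _) (_ | _ | _ | _ | _) <;> simp)

open PExp

/-- The expression matching one arbitrary symbol. -/
def anySym {ν : Type} : PExp DSym ν :=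
  .choice (.term .b0) (.choice (.term .b1) (.term .dollar))

theorem den_anySym {ν : Type} (ρ : ν → List DSym → Option (List DSym)) (s : List DSym) :
    den ρ anySym s = if s = [] then none else some s.tail := by
  cases s with
  | nil => rfl
  | cons c s => cases c <;> rfl

def topIs : Option Γ → PExp DSym (NT K Γ Q)
  | none => .notP anySym
  | some a => .nt (.pushed a)

/-- The last transition was made in state `p.1`, reading `p.2.1`, with `p.2.2` on top of the
inspected stack. -/
def transIs (p : Q × DSym × Option Γ) : PExp DSym (NT K Γ Q) :=
  .andP (.seq (.term p.2.1) (.seq (.nt (.state p.1))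
    (.seq (.nt (.stack (M.κ p.1))) (topIs p.2.2))))

theorem guarded_anySym {ν : Type} : (anySym : PExp DSym ν).Guarded :=
  .choice (.term _) (.choice (.term _) (.term _))

theorem guarded_transIs (p : Q × DSym × Option Γ) : (M.transIs p).Guarded :=
  .andP (.termSeq _ _)

theorem den_transIs_nil {ρ : NT K Γ Q → List DSym → Option (List DSym)}
    (p : Q × DSym × Option Γ) : den ρ (M.transIs p) [] = none := rfl

variable [DecidableEq K]

def step (c : DSym) (C : Q × (K → List Γ)) : Q × (K → List Γ) :=
  let p := M.δ C.1 c (C.2 (M.κ C.1)).head?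
  (p.1, Function.update C.2 (M.κ C.1) (p.2.app (C.2 (M.κ C.1))))

/-- The configuration after reading a string from right to left. -/
def run : List DSym → Q × (K → List Γ)
  | [] => (M.start, fun _ => [])
  | c :: s => M.step c (run s)

/-- The same as `run`, where every stack cell also records the suffix of the input at whose
reading it was pushed. -/
def markedRun : List DSym → Q × (K → List (List DSym × Γ))
  | [] => (M.start, fun _ => [])
  | c :: s =>
    let C := markedRun s
    let p := M.δ C.1 c ((C.2 (M.κ C.1)).head?.map Prod.snd)
    (p.1, Function.update C.2 (M.κ C.1)
      ((p.2.map fun a => (c :: s, a)).app (C.2 (M.κ C.1))))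

theorem run_eq_markedRun (s : List DSym) :
    M.run s = ((M.markedRun s).1, fun k => ((M.markedRun s).2 k).map Prod.snd) := by
  induction s with
  | nil => rfl
  | cons c s ih =>
    simp only [run, step, ih, markedRun, List.head?_map]
    refine Prod.ext rfl (funext fun k => ?_)
    by_cases h : k = M.κ (M.markedRun s).1
    · subst h
      simp [StackAct.map_app, StackAct.map_map_snd]
    · simp [h]

/-- The transition taken on reading the first symbol of a string. -/
def trans : List DSym → Option (Q × StackAct Γ)
  | [] => none
  | c :: s =>
    let C := M.markedRun s
    some (M.δ C.1 c ((C.2 (M.κ C.1)).head?.map Prod.snd))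

theorem markedRun_cell (s : List DSym) (k : K) {t : List DSym} {a : Γ}
    {l : List (List DSym × Γ)} (h : (M.markedRun s).2 k = (t, a) :: l) :
    (M.trans t).map Prod.snd = some (.push a) ∧ t.length ≤ s.length ∧
      ∃ c t', t = c :: t' ∧ (M.markedRun t').2 k = l := by
  induction hn : s.length using Nat.strong_induction_on generalizing s t a l with
  | _ n ih =>
    subst hn
    cases s with
    | nil => simp [markedRun] at h
    | cons c s =>
      by_cases hk : k = M.κ (M.markedRun s).1
      · simp only [markedRun, ← hk, Function.update_self] at h
        cases hu : (M.δ (M.markedRun s).1 c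
            (((M.markedRun s).2 k).head?.map Prod.snd)).2 with
        | keep =>
          simp only [hu, StackAct.map, StackAct.app] at h
          obtain ⟨h₁, h₂, h₃⟩ := ih s.length (by simp) s h rfl
          exact ⟨h₁, h₂.trans (by simp), h₃⟩
        | pop =>
          simp only [hu, StackAct.map, StackAct.app] at h
          cases hl : (M.markedRun s).2 k with
          | nil => simp [hl] at h
          | cons p l' =>
            obtain ⟨-, h₂, c', t', ht, h₃⟩ :=
              ih s.length (by simp) s (t := p.1) (a := p.2) hl rfl
            simp only [hl, List.tail_cons] at h
            have hlt : t'.length < s.length := by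
              rw [ht] at h₂; simpa using h₂
            obtain ⟨g₁, g₂, g₃⟩ := ih t'.length (by simp; omega) t' (h₃.trans h) rfl
            exact ⟨g₁, by simp; omega, g₃⟩
        | push b =>
          simp only [hu, StackAct.map, StackAct.app, List.cons.injEq, Prod.mk.injEq] at h
          obtain ⟨⟨rfl, rfl⟩, rfl⟩ := h
          refine ⟨?_, le_rfl, c, s, rfl, rfl⟩
          simp only [trans, Option.map_some, ← hk, hu]
      · simp only [markedRun, Function.update_of_ne hk] at h
        obtain ⟨h₁, h₂, h₃⟩ := ih s.length (by simp) s h rfl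
        exact ⟨h₁, h₂.trans (by simp), h₃⟩

/-- The suffix at whose reading the top cell of a stack was pushed. -/
def ptr (k : K) (s : List DSym) : List DSym :=
  (((M.markedRun s).2 k).head?.map Prod.fst).getD []

theorem ptr_trans (s : List DSym) (k : K) :
    (M.trans (M.ptr k s)).map Prod.snd = ((M.run s).2 k).head?.map .push := by
  rw [run_eq_markedRun]
  cases h : (M.markedRun s).2 k with
  | nil => simp [ptr, h, trans]
  | cons p l => simpa [ptr, h] using (M.markedRun_cell s k h).1

theorem ptr_eq_nil (s : List DSym) (k : K) : M.ptr k s = [] ↔ (M.run s).2 k = [] := by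
  rw [run_eq_markedRun]
  cases h : (M.markedRun s).2 k with
  | nil => simp [ptr, h]
  | cons p l =>
    obtain ⟨-, -, c, t, hp, -⟩ := M.markedRun_cell s k h
    simp [ptr, h, hp]

theorem run_tail_ptr (s : List DSym) (k : K) :
    (M.run (M.ptr k s).tail).2 k = ((M.run s).2 k).tail := by
  simp only [run_eq_markedRun]
  unfold ptr
  cases h : (M.markedRun s).2 k with
  | nil => rfl
  | cons p l =>
    obtain ⟨-, -, c, t, h, h'⟩ := M.markedRun_cell s k h
    simp [h, h']

theorem ptr_tail_ptr (s : List DSym) (k : K) :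
    M.ptr k (M.ptr k s).tail = ((((M.markedRun s).2 k).tail).head?.map Prod.fst).getD [] := by
  cases h : (M.markedRun s).2 k with
  | nil => simp [ptr, h, markedRun]
  | cons p l =>
    obtain ⟨-, -, c, t, h₁, h₂⟩ := M.markedRun_cell s k h
    simp [ptr, h, h₁, h₂]

theorem trans_cons (c : DSym) (s : List DSym) :
    M.trans (c :: s) =
      some (M.δ (M.run s).1 c ((M.run s).2 (M.κ (M.run s).1)).head?) := by
  simp [trans, run_eq_markedRun]

theorem ptr_cons (k : K) (c : DSym) (s : List DSym) :
    M.ptr k (c :: s) =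
      if k = M.κ (M.run s).1 then
        match (M.δ (M.run s).1 c ((M.run s).2 (M.κ (M.run s).1)).head?).2 with
        | .keep => M.ptr k s
        | .pop => M.ptr k (M.ptr k s).tail
        | .push _ => c :: s
      else M.ptr k s := by
  rw [ptr_tail_ptr]
  simp only [run_eq_markedRun, List.head?_map]
  by_cases hk : k = M.κ (M.markedRun s).1
  · subst hk
    rw [if_pos rfl]
    simp only [ptr, markedRun, Function.update_self]
    split <;> simp_all [StackAct.map, StackAct.app]
  · rw [if_neg hk]
    simp [ptr, markedRun, Function.update_of_ne hk]

def move (p : Q × DSym × Option Γ) (k : K) : PExp DSym (NT K Γ Q) :=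
  if k = M.κ p.1 then
    match (M.δ p.1 p.2.1 p.2.2).2 with
    | .keep => .seq (.term p.2.1) (.nt (.stack k))
    | .pop => .seq (.term p.2.1) (.seq (.nt (.stack k))
        (.choice (.seq anySym (.nt (.stack k))) .eps))
    | .push _ => .eps
  else .seq (.term p.2.1) (.nt (.stack k))

/-- In state `q₁` or `q₂`, with `a`, `b` the top cells of stack `k`. -/
def acceptExp (q₁ q₂ : Q) (k : K) (a b : Γ) : PExp DSym (NT K Γ Q) :=
  .seq (.choice (.nt (.state q₁)) (.nt (.state q₂)))
    (.seq (.andP (.seq (.nt (.stack k)) (.seq (.nt (.pushed a))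
      (.seq anySym (.seq (.nt (.stack k)) (.nt (.pushed b)))))))
      (.nt .rest))

open Classical in
/-- The rules, save for the one for acceptance. -/
noncomputable def preRule [Fintype Γ] [Fintype Q] : NT K Γ Q → PExp DSym (NT K Γ Q)
  | .state q => .choice
      (choices ((Finset.univ.toList : List (Q × DSym × Option Γ)).map fun p =>
        if (M.δ p.1 p.2.1 p.2.2).1 = q then M.transIs p else .fail))
      (if M.start = q then .notP anySym else .fail)
  | .stack k => .choice
      (choices ((Finset.univ.toList : List (Q × DSym × Option Γ)).map fun p =>
        .seq (M.transIs p) (M.move p k)))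
      .eps
  | .pushed a =>
      choices ((Finset.univ.toList : List (Q × DSym × Option Γ)).map fun p =>
        if (M.δ p.1 p.2.1 p.2.2).2 = .push a then M.transIs p else .fail)
  | .rest => .choice (.seq (.term .b0) (.nt .rest)) (.choice (.seq (.term .b1) (.nt .rest))
      (.choice (.seq (.term .dollar) (.nt .rest)) .eps))
  | .accept => .fail

noncomputable def rule [Fintype Γ] [Fintype Q] (q₁ q₂ : Q) (k : K) (a b : Γ) :
    NT K Γ Q → PExp DSym (NT K Γ Q)
  | .accept => inline M.preRule (acceptExp q₁ q₂ k a b)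
  | A => M.preRule A

theorem guarded_move (p : Q × DSym × Option Γ) (k : K) : (M.move p k).Guarded := by
  unfold move
  split
  · split
    · exact .termSeq _ _
    · exact .termSeq _ _
    · exact .eps
  · exact .termSeq _ _

theorem guarded_preRule [Fintype Γ] [Fintype Q] (A : NT K Γ Q) : (M.preRule A).Guarded := by
  cases A with
  | state q =>
    refine .choice (guarded_choices fun e he => ?_) ?_
    · obtain ⟨p, -, rfl⟩ := List.mem_map.1 he
      split
      · exact M.guarded_transIs p
      · exact .fail
    · split
      · exact guarded_anySym.notP
      · exact .fail
  | stack k =>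
    refine .choice (guarded_choices fun e he => ?_) .eps
    obtain ⟨p, -, rfl⟩ := List.mem_map.1 he
    exact (M.guarded_transIs p).seq (M.guarded_move p k)
  | pushed a =>
    refine guarded_choices fun e he => ?_
    obtain ⟨p, -, rfl⟩ := List.mem_map.1 he
    split
    · exact M.guarded_transIs p
    · exact .fail
  | rest =>
    exact .choice (.termSeq _ _) (.choice (.termSeq _ _) (.choice (.termSeq _ _) .eps))
  | accept => exact .fail

theorem guarded_rule [Fintype Γ] [Fintype Q] (q₁ q₂ : Q) (k : K) (a b : Γ) (A : NT K Γ Q) :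
    (M.rule q₁ q₂ k a b A).Guarded := by
  cases A with
  | accept => exact guarded_inline M.guarded_preRule _
  | state q => exact M.guarded_preRule (.state q)
  | stack k => exact M.guarded_preRule (.stack k)
  | pushed a => exact M.guarded_preRule (.pushed a)
  | rest => exact M.guarded_preRule .rest

def Accepts (q₁ q₂ : Q) (k : K) (a b : Γ) (s : List DSym) : Prop :=
  ((M.run s).1 = q₁ ∨ (M.run s).1 = q₂) ∧ ∃ l, (M.run s).2 k = a :: b :: l

open Classical in
/-- The intended meaning of the non-terminals other than `accept`. -/
noncomputable def preSem : NT K Γ Q → List DSym → Option (List DSym)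
  | .state q, s => if (M.run s).1 = q then some s else none
  | .stack k, s => some (M.ptr k s)
  | .pushed a, s => if (M.trans s).map Prod.snd = some (.push a) then some s else none
  | .rest, _ => some []
  | .accept, _ => none

open Classical in
noncomputable def sem (q₁ q₂ : Q) (k : K) (a b : Γ) :
    NT K Γ Q → List DSym → Option (List DSym)
  | .accept, s => if M.Accepts q₁ q₂ k a b s then some [] else none
  | A, s => M.preSem A s

open Classical in
theorem den_topIs {ρ : NT K Γ Q → List DSym → Option (List DSym)}
    (hpushed : ∀ a, ρ (.pushed a) = M.preSem (.pushed a)) (o : Option Γ) (k : K) (s : List DSym) :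
    den ρ (topIs o) (M.ptr k s) =
      if ((M.run s).2 k).head? = o then some (M.ptr k s) else none := by
  cases o with
  | none =>
    by_cases h : (M.run s).2 k = [] <;>
      simp [topIs, den, den_anySym, ptr_eq_nil, h]
  | some a =>
    simp only [topIs, den, hpushed, preSem, ptr_trans]
    cases ((M.run s).2 k).head? <;> simp

/-- The data determining the transition made on reading `c` in front of `s`. -/
def transData (c : DSym) (s : List DSym) : Q × DSym × Option Γ :=
  ((M.run s).1, c, ((M.run s).2 (M.κ (M.run s).1)).head?)

open Classical in
theorem den_transIs {ρ : NT K Γ Q → List DSym → Option (List DSym)}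
    (hstate : ∀ q, ρ (.state q) = M.preSem (.state q))
    (hstack : ∀ k, ρ (.stack k) = M.preSem (.stack k))
    (hpushed : ∀ a, ρ (.pushed a) = M.preSem (.pushed a))
    (p : Q × DSym × Option Γ) (c : DSym) (s : List DSym) :
    den ρ (M.transIs p) (c :: s) = if p = M.transData c s then some (c :: s) else none := by
  obtain ⟨q, d, o⟩ := p
  simp only [transIs, transData, den, hstate, hstack, preSem]
  by_cases hd : d = c
  · subst hd
    by_cases hq : (M.run s).1 = q
    · subst hq
      by_cases ho : ((M.run s).2 (M.κ (M.run s).1)).head? = o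
      · simp [M.den_topIs hpushed, ho]
      · simp [M.den_topIs hpushed, ho, Ne.symm ho]
    · simp [hq, Ne.symm hq]
  · simp [hd]

theorem den_move {ρ : NT K Γ Q → List DSym → Option (List DSym)}
    (hstack : ∀ k, ρ (.stack k) = M.preSem (.stack k)) (k : K) (c : DSym) (s : List DSym) :
    den ρ (M.move (M.transData c s) k) (c :: s) = some (M.ptr k (c :: s)) := by
  rw [ptr_cons]
  unfold move transData
  dsimp only
  split
  · split
    · simp [den, hstack, preSem]
    · simp only [den, if_true, Option.bind_some, hstack, preSem, den_anySym]
      by_cases h : M.ptr k s = []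
      · have h' : M.ptr k [] = [] := by simp [ptr, markedRun]
        simp [h, h']
      · simp [h]
    · simp [den]
  · simp [den, hstack, preSem]

open Classical in
theorem den_preRule [Fintype Γ] [Fintype Q] {ρ : NT K Γ Q → List DSym → Option (List DSym)}
    (hρ : ∀ A, A ≠ .accept → ρ A = M.preSem A) (A : NT K Γ Q) (s : List DSym) :
    den ρ (M.preRule A) s = M.preSem A s := by
  have hstate : ∀ q, ρ (.state q) = M.preSem (.state q) := fun q => hρ _ (by simp)
  have hstack : ∀ q, ρ (.stack q) = M.preSem (.stack q) := fun q => hρ _ (by simp)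
  have hpushed : ∀ q, ρ (.pushed q) = M.preSem (.pushed q) := fun q => hρ _ (by simp)
  have hrest : ρ .rest = M.preSem .rest := hρ _ (by simp)
  have ht := M.den_transIs hstate hstack hpushed
  cases A with
  | state q =>
    cases s with
    | nil =>
      simp only [preRule, den]
      rw [den_choices (z := [])]
      · rw [if_neg, Option.none_or]
        · by_cases h : M.start = q <;> simp [h, den, den_anySym, preSem, run]
        · rintro ⟨e, he, h⟩
          obtain ⟨p, -, rfl⟩ := List.mem_map.1 he
          split at h <;> simp [den, den_transIs_nil] at h
      · intro e he
        obtain ⟨p, -, rfl⟩ := List.mem_map.1 he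
        split <;> simp [den, den_transIs_nil]
    | cons c s =>
      simp only [preRule, den]
      rw [den_choices (z := c :: s)]
      · have : den ρ (if M.start = q then .notP anySym else .fail) (c :: s) = none := by
          split <;> simp [den, den_anySym]
        rw [this, Option.or_none]
        simp only [preSem, run, step]
        congr 1
        simp only [List.mem_map, Finset.mem_toList, Finset.mem_univ, true_and,
          exists_exists_eq_and, eq_iff_iff]
        constructor
        · rintro ⟨p, hp⟩
          split at hp
          · next h =>
            rw [ht] at hp
            split at hp
            · next h' => subst h'; exact h
            · simp at hp
          · simp [den] at hp
        · intro h
          refine ⟨M.transData c s, ?_⟩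
          rw [if_pos (by exact h), ht, if_pos rfl]
      · intro e he
        obtain ⟨p, -, rfl⟩ := List.mem_map.1 he
        split
        · rw [ht]; split <;> simp
        · simp [den]
  | stack k =>
    cases s with
    | nil =>
      simp only [preRule, den]
      rw [den_choices (z := [])]
      · rw [if_neg, Option.none_or]
        · simp [preSem, ptr, markedRun]
        · rintro ⟨e, he, h⟩
          obtain ⟨p, -, rfl⟩ := List.mem_map.1 he
          simp [den, den_transIs_nil] at h
      · intro e he
        obtain ⟨p, -, rfl⟩ := List.mem_map.1 he
        simp [den, den_transIs_nil]
    | cons c s =>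
      have hm := M.den_move hstack k c s
      have key : ∀ p, den ρ (.seq (M.transIs p) (M.move p k)) (c :: s) =
          if p = M.transData c s then some (M.ptr k (c :: s)) else none := by
        intro p
        simp only [den, ht]
        split
        · next h => subst h; simpa using hm
        · simp
      simp only [preRule, den]
      rw [den_choices (z := M.ptr k (c :: s))]
      · rw [if_pos, Option.some_or, preSem]
        exact ⟨_, List.mem_map.2 ⟨M.transData c s, by simp, rfl⟩, by rw [key, if_pos rfl]⟩
      · intro e he
        obtain ⟨p, -, rfl⟩ := List.mem_map.1 he
        rw [key]; split <;> simp
  | pushed a =>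
    cases s with
    | nil =>
      simp only [preRule]
      rw [den_choices (z := [])]
      · rw [if_neg]
        · simp [preSem, trans]
        · rintro ⟨e, he, h⟩
          obtain ⟨p, -, rfl⟩ := List.mem_map.1 he
          split at h <;> simp [den, den_transIs_nil] at h
      · intro e he
        obtain ⟨p, -, rfl⟩ := List.mem_map.1 he
        split <;> simp [den, den_transIs_nil]
    | cons c s =>
      simp only [preRule]
      rw [den_choices (z := c :: s)]
      · simp only [preSem, trans_cons]
        congr 1
        simp only [List.mem_map, Finset.mem_toList, Finset.mem_univ, true_and,
          exists_exists_eq_and, eq_iff_iff, Option.map_some, Option.some.injEq]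
        constructor
        · rintro ⟨p, hp⟩
          split at hp
          · next h =>
            rw [ht] at hp
            split at hp
            · next h' => subst h'; exact h
            · simp at hp
          · simp [den] at hp
        · intro h
          refine ⟨M.transData c s, ?_⟩
          rw [if_pos (by exact h), ht, if_pos rfl]
      · intro e he
        obtain ⟨p, -, rfl⟩ := List.mem_map.1 he
        split
        · rw [ht]; split <;> simp
        · simp [den]
  | rest =>
    cases s with
    | nil => rfl
    | cons c s => cases c <;> simp [preRule, den, hrest, preSem]
  | accept => rfl

open Classical in
theorem den_acceptExp {ρ : NT K Γ Q → List DSym → Option (List DSym)}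
    (hρ : ∀ A, A ≠ .accept → ρ A = M.preSem A) (q₁ q₂ : Q) (k : K) (a b : Γ) (s : List DSym) :
    den ρ (acceptExp q₁ q₂ k a b) s = if M.Accepts q₁ q₂ k a b s then some [] else none := by
  have hstate : ∀ q, ρ (.state q) = M.preSem (.state q) := fun q => hρ _ (by simp)
  have hstack : ∀ q, ρ (.stack q) = M.preSem (.stack q) := fun q => hρ _ (by simp)
  have hpushed : ∀ q, ρ (.pushed q) = M.preSem (.pushed q) := fun q => hρ _ (by simp)
  have hrest : ρ .rest = M.preSem .rest := hρ _ (by simp)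
  by_cases hq : (M.run s).1 = q₁ ∨ (M.run s).1 = q₂
  · have h₁ : den ρ (.choice (.nt (.state q₁)) (.nt (.state q₂))) s = some s := by
      simp only [den, hstate, preSem]
      rcases hq with h | h
      · simp [h]
      · by_cases h' : q₂ = q₁ <;> simp [h, h']
    have h₂ : ∀ (c : Γ) t, den ρ (.nt (.pushed c)) (M.ptr k t) =
        if ((M.run t).2 k).head? = some c then some (M.ptr k t) else none := fun c t =>
      M.den_topIs hpushed (some c) k t
    have h₃ : ∀ t, den ρ (.nt (.stack k)) t = some (M.ptr k t) := fun t => by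
      simp [den, hstack, preSem]
    unfold acceptExp Accepts
    rw [den, h₁, Option.bind_some, den, den, den, h₃, Option.bind_some, den, h₂]
    cases hl : (M.run s).2 k with
    | nil => simp
    | cons c l =>
      have hne : M.ptr k s ≠ [] := by rw [Ne, ptr_eq_nil, hl]; simp
      by_cases hc : c = a
      · subst hc
        have h₄ := M.run_tail_ptr s k
        rw [hl, List.tail_cons] at h₄
        rw [List.head?_cons, if_pos rfl, Option.bind_some, den, den_anySym, if_neg hne,
          Option.bind_some, den, h₃, Option.bind_some, h₂, h₄]
        cases l with
        | nil => simp
        | cons d l => by_cases hd : d = b <;> simp [hd, hq, den, hrest, preSem]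
      · simp [hc]
  · have h₁ : den ρ (.choice (.nt (.state q₁)) (.nt (.state q₂))) s = none := by
      obtain ⟨h, h'⟩ := not_or.1 hq
      simp [den, hstate, preSem, h, h']
    unfold acceptExp Accepts
    rw [den, h₁]
    simp [hq]

theorem den_rule [Fintype Γ] [Fintype Q] (q₁ q₂ : Q) (k : K) (a b : Γ)
    (A : NT K Γ Q) (s : List DSym) :
    den (M.sem q₁ q₂ k a b) (M.rule q₁ q₂ k a b A) s = M.sem q₁ q₂ k a b A s := by
  have hsem : ∀ A, A ≠ .accept → M.sem q₁ q₂ k a b A = M.preSem A := by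
    intro A hA
    cases A <;> first | rfl | exact absurd rfl hA
  cases A with
  | accept =>
    exact (den_inline (M.den_preRule hsem) _ s).trans
      (M.den_acceptExp (ρ := M.preSem) (fun _ _ => rfl) q₁ q₂ k a b s)
  | state q => exact M.den_preRule hsem (.state q) s
  | stack k => exact M.den_preRule hsem (.stack k) s
  | pushed a => exact M.den_preRule hsem (.pushed a) s
  | rest => exact M.den_preRule hsem .rest s

theorem isPEGLang_accepts [Finite K] [Finite Γ] [Finite Q] (q₁ q₂ : Q) (k : K) (a b : Γ) :
    IsPEGLang {s | M.Accepts q₁ q₂ k a b s} := by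
  have := Fintype.ofFinite Γ
  have := Fintype.ofFinite Q
  have key := leaves_of_guarded (M.guarded_rule q₁ q₂ k a b) (M.den_rule q₁ q₂ k a b)
  refine ⟨⟨NT K Γ Q, inferInstance, M.rule q₁ q₂ k a b, .accept⟩, fun e x => ?_, ?_⟩
  · have h := key e x
    revert h
    cases den (M.sem q₁ q₂ k a b) e x with
    | none => exact fun h => ⟨_, h⟩
    | some z => exact fun ⟨y, _, h⟩ => ⟨_, h⟩
  · ext s
    have h := key (.nt .accept) s
    simp only [PEG.Lang, Set.mem_ofPred_eq]
    simp only [den, sem] at h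
    split at h
    · next hs =>
      obtain ⟨y, hy, h⟩ := h
      rw [List.append_nil] at hy
      subst hy
      exact ⟨fun _ => hs, fun _ => h⟩
    · next hs =>
      exact ⟨fun h' => absurd (h.unique h') (by simp), fun h' => absurd h' hs⟩

end StackAut

/-- The number whose binary expansion is a leading `1` followed by the reverse of the list. -/
def bitsToNat (l : List Bool) : ℕ :=
  l.foldr (fun b n => 2 * n + b.toNat) 1

theorem bitsToNat_injective : Function.Injective bitsToNat := by
  have pos : ∀ l, 0 < bitsToNat l := by
    intro l
    induction l with
    | nil => simp [bitsToNat]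
    | cons b l ih => simp only [bitsToNat, List.foldr_cons] at ih ⊢; omega
  intro l
  induction l with
  | nil =>
    rintro (_ | ⟨b, l⟩) h
    · rfl
    · have := pos l
      simp only [bitsToNat, List.foldr_cons, List.foldr_nil] at h this
      omega
  | cons a l ih =>
    rintro (_ | ⟨b, m⟩) h
    · have := pos l
      simp only [bitsToNat, List.foldr_cons, List.foldr_nil] at h this
      omega
    · have h' : bitsToNat l = bitsToNat m ∧ a = b := by
        simp only [bitsToNat, List.foldr_cons] at h ⊢
        cases a <;> cases b <;> simp at h ⊢ <;> omega
      rw [ih h'.1, h'.2]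

theorem primrec_bitsToNat : Primrec bitsToNat := by
  refine Primrec.list_foldr (h := fun (_ : List Bool) (p : Bool × ℕ) => 2 * p.2 + p.1.toNat) .id (.const 1) ?_
  exact Primrec.nat_add.comp
    (Primrec.nat_mul.comp (.const 2) (Primrec.snd.comp Primrec.snd))
    ((Primrec.dom_finite Bool.toNat).comp (Primrec.fst.comp Primrec.snd))

open Turing ToPartrec in
theorem exists_code_bitsToNat {f : List Bool → List Bool} (hf : Computable f) :
    ∃ c : Code, ∀ x, [bitsToNat (f x).reverse] ∈ c.eval [bitsToNat x.reverse] := by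
  let F : ℕ → ℕ → Option ℕ := fun n i =>
    (Encodable.decode (α := List Bool) i).bind fun x =>
      if bitsToNat x.reverse = n then some (bitsToNat (f x).reverse) else none
  have hF : Computable₂ F := by
    refine Computable.option_bind (Computable.decode.comp Computable.snd) ?_
    have h₁ : Computable fun p : (ℕ × ℕ) × List Bool =>
        decide (bitsToNat p.2.reverse = p.1.1) :=
      (Primrec.eq.decide.comp (primrec_bitsToNat.comp (Primrec.list_reverse.comp Primrec.snd))
        (Primrec.fst.comp Primrec.fst)).to_comp
    have h₂ : Computable fun p : (ℕ × ℕ) × List Bool => some (bitsToNat (f p.2).reverse) :=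
      Computable.option_some.comp ((primrec_bitsToNat.comp Primrec.list_reverse).to_comp.comp
        (hf.comp Computable.snd))
    exact (Computable.cond h₁ h₂ (Computable.const none)).of_eq fun p => by
      by_cases h : bitsToNat p.2.reverse = p.1.1 <;> simp [h]
  have hp : Partrec fun n => Nat.rfindOpt (F n) := Partrec.rfindOpt hF
  obtain ⟨c, hc⟩ := Code.exists_code (Nat.Partrec'.part_iff₁.2 hp)
  refine ⟨c, fun x => ?_⟩
  have := hc (bitsToNat x.reverse ::ᵥ List.Vector.nil)
  have hx : bitsToNat (f x).reverse ∈ Nat.rfindOpt (F (bitsToNat x.reverse)) := by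
    have hd : (Nat.rfindOpt (F (bitsToNat x.reverse))).Dom :=
      Nat.rfindOpt_dom.2 ⟨Encodable.encode x, bitsToNat (f x).reverse, by simp [F]⟩
    obtain ⟨i, hi⟩ := Nat.rfindOpt_spec ⟨hd, rfl⟩
    obtain ⟨y, -, hy⟩ := Option.bind_eq_some_iff.1 hi
    split at hy
    · next h =>
      obtain rfl : y = x := List.reverse_injective (bitsToNat_injective h)
      rw [Option.some.inj hy]
      exact Part.get_mem hd
    · simp at hy
  change c.eval [bitsToNat x.reverse] = _ at this
  rw [this]
  exact (Part.mem_map_iff _).2 ⟨_, hx, rfl⟩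

open Turing PartrecToTM2

def bitSym (b : Bool) : Γ' := if b then .bit1 else .bit0

theorem bitSym_injective : Function.Injective bitSym := by
  intro a b; cases a <;> cases b <;> simp [bitSym]

theorem trList_bitsToNat (l : List Bool) :
    trList [bitsToNat l] = l.map bitSym ++ [.bit1, .cons] := by
  let p : List Bool → PosNum := fun l => l.foldr PosNum.bit .one
  have h : ∀ l, bitsToNat l = (p l : ℕ) := by
    intro l
    induction l with
    | nil => rfl
    | cons b l ih =>
      have : bitsToNat (b :: l) = 2 * bitsToNat l + b.toNat := rfl
      rw [this, ih]
      cases b <;> simp [p, PosNum.bit] <;> omega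
  have h' : ∀ l, trPosNum (p l) = l.map bitSym ++ [.bit1] := by
    intro l
    induction l with
    | nil => rfl
    | cons b l ih => cases b <;> simpa [p, PosNum.bit, trPosNum, bitSym] using ih
  simp [trList, trNat, h, trNum, h']

theorem map_bitSym_append_inj {u v : List Bool} {l : List Γ'}
    (h : u.map bitSym ++ [.bit1, .cons] = v.map bitSym ++ .bit1 :: .cons :: l) : u = v := by
  induction u generalizing v with
  | nil =>
    match v with
    | [] => rfl
    | [b] => simp at h
    | b :: b' :: v => cases b' <;> simp [bitSym] at h
  | cons a u ih =>
    cases v with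
    | nil =>
      cases u with
      | nil => simp at h
      | cons b u => cases b <;> simp [bitSym] at h
    | cons b v =>
      simp only [List.map_cons, List.cons_append, List.cons.injEq] at h
      rw [bitSym_injective h.1, ih h.2]

namespace StackAut

variable {K Γ Q : Type} [DecidableEq K] (M : StackAut K Γ Q)

theorem primrec_step [Primcodable Q] [Finite Q] [Primcodable Γ] [Finite Γ] {n : ℕ}
    (e : K ≃ Fin n) (c : DSym) :
    letI : Primcodable (K → List Γ) :=
      .ofEquiv (Fin n → List Γ) (e.arrowCongr (Equiv.refl (List Γ)))
    Primrec (M.step c) := by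
  let E : (K → List Γ) ≃ (Fin n → List Γ) := e.arrowCongr (Equiv.refl (List Γ))
  let _ : Primcodable (K → List Γ) := .ofEquiv (Fin n → List Γ) E
  have hE : Primrec E := Primrec.of_equiv
  have hκ : Primrec fun C : Q × (K → List Γ) => e (M.κ C.1) :=
    (Primrec.dom_finite fun q => e (M.κ q)).comp Primrec.fst
  have htop : Primrec fun C : Q × (K → List Γ) => C.2 (M.κ C.1) :=
    (Primrec.fin_app.comp (hE.comp Primrec.snd) hκ).of_eq fun C => by simp [E]
  have hact : Primrec₂ fun (p : Bool × Option Γ) (l : List Γ) =>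
      ((if p.1 then (match p.2 with | some a => .push a | none => .pop) else .keep) :
        StackAct Γ).app l := by
    have h₁ : Primrec fun x : (Bool × Option Γ) × List Γ =>
        Option.casesOn (motive := fun _ => List Γ) x.1.2 x.2.tail (fun a => a :: x.2) :=
      Primrec.option_casesOn (Primrec.snd.comp Primrec.fst) (Primrec.list_tail.comp Primrec.snd)
        (Primrec.list_cons.comp Primrec.snd (Primrec.snd.comp Primrec.fst))
    refine (Primrec.cond (Primrec.fst.comp Primrec.fst) h₁ Primrec.snd).of_eq ?_
    rintro ⟨⟨b, o⟩, l⟩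
    cases b <;> cases o <;> rfl
  have hδ : ∀ {σ : Type} [Primcodable σ] (F : Q × StackAct Γ → σ),
      Primrec fun C : Q × (K → List Γ) => F (M.δ C.1 c (C.2 (M.κ C.1)).head?) := by
    intro σ _ F
    exact (Primrec.dom_finite fun p : Q × Option Γ => F (M.δ p.1 c p.2)).comp
      (Primrec.fst.pair (Primrec.list_head?.comp htop))
  have hnew : Primrec fun C : Q × (K → List Γ) =>
      (M.δ C.1 c (C.2 (M.κ C.1)).head?).2.app (C.2 (M.κ C.1)) := by
    refine (hact.comp (hδ fun p => match p.2 with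
      | .keep => (false, none)
      | .pop => (true, none)
      | .push a => (true, some a)) htop).of_eq fun C => ?_
    cases (M.δ C.1 c (C.2 (M.κ C.1)).head?).2 <;> rfl
  refine (hδ Prod.fst).pair ?_
  refine Primrec.of_equiv_iff E |>.1 ?_
  refine Primrec.fin_curry.2 ?_
  refine (Primrec.ite (Primrec.eq.comp Primrec.snd (hκ.comp Primrec.fst))
    (hnew.comp Primrec.fst)
    (Primrec.fin_app.comp (hE.comp (Primrec.snd.comp Primrec.fst)) Primrec.snd)).of_eq ?_
  rintro ⟨C, j⟩
  by_cases h : j = e (M.κ C.1)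
  · subst h; simp [E]
  · have : e.symm j ≠ M.κ C.1 := fun h' => h (by simp [← h'])
    simp [E, h, this]

/-- The time at which a state is first reached on a constant input is computable from the initial
content of a stack. -/
theorem computable_find [Finite K] [Finite Γ] [Finite Q] (c : DSym) (q₀ q : Q) (k : K)
    (enc : Bool → Γ)
    [∀ (x : List Bool) (n : ℕ), Decidable
      (((M.step c)^[n] (q₀, Function.update (fun _ => []) k (x.map enc))).1 = q)]
    (h : ∀ x : List Bool,
      ∃ n, ((M.step c)^[n] (q₀, Function.update (fun _ => []) k (x.map enc))).1 = q) :
    Computable fun x => Nat.find (h x) := by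
  let _ : Primcodable Q := .ofEquiv _ (Finite.equivFin Q)
  let _ : Primcodable Γ := .ofEquiv _ (Finite.equivFin Γ)
  let e := Finite.equivFin K
  let E : (K → List Γ) ≃ (Fin (Nat.card K) → List Γ) := e.arrowCongr (Equiv.refl (List Γ))
  let _ : Primcodable (K → List Γ) := .ofEquiv _ E
  have hstep : Primrec (M.step c) := M.primrec_step e c
  have hinit : Primrec fun x : List Bool =>
      (q₀, Function.update (fun _ => []) k (x.map enc)) := by
    refine (Primrec.const q₀).pair (Primrec.of_equiv_iff E |>.1 (Primrec.fin_curry.2 ?_))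
    refine (Primrec.ite (Primrec.eq.comp Primrec.snd (Primrec.const (e k)))
      ((Primrec.list_map Primrec.id ((Primrec.dom_finite enc).comp₂ Primrec₂.right)).comp
        Primrec.fst) (Primrec.const [])).of_eq ?_
    rintro ⟨x, j⟩
    by_cases hj : j = e k
    · subst hj; simp [E]
    · have : e.symm j ≠ k := fun h' => hj (by simp [← h'])
      simp [E, hj, this]
  have hdec : Primrec₂ fun (x : List Bool) (n : ℕ) => decide
      (((M.step c)^[n] (q₀, Function.update (fun _ => []) k (x.map enc))).1 = q) := by
    have : Primrec fun p : List Bool × ℕ =>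
        ((M.step c)^[p.2] (q₀, Function.update (fun _ => []) k (p.1.map enc))).1 :=
      Primrec.fst.comp (Primrec.nat_iterate Primrec.snd (hinit.comp Primrec.fst)
        (hstep.comp₂ Primrec₂.right))
    classical
    exact ((Primrec.dom_finite fun r : Q => decide (r = q)).comp this).of_eq fun p => by simp
  refine Partrec.of_eq (Partrec.rfind hdec.to_comp.partrec₂) fun x => ?_
  refine Part.eq_some_iff.2 (Nat.mem_rfind.2 ⟨?_, fun {m} hm => ?_⟩)
  · simpa using Nat.find_spec (h x)
  · simpa using Nat.find_min (h x) hm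

end StackAut

open TM2 (Stmt stmts stmts₁)

instance : Finite K' :=
  Finite.of_injective (β := Fin 4) (fun | .main => 0 | .rev => 1 | .aux => 2 | .stack => 3) (by
    rintro (_ | _ | _ | _) (_ | _ | _ | _) h <;> simp at h ⊢)

/-- The statements of the programs of the partial recursive codes. -/
abbrev CodeStmt : Type := Stmt (fun _ : K' => Γ') Λ' (Option Γ')

/-- The configurations of the programs of the partial recursive codes. -/
abbrev CodeCfg : Type := TM2.Cfg (fun _ : K' => Γ') Λ' (Option Γ')

def program (l : Λ') : CodeStmt := tr l

/-- The statements occurring in the program of `c`. -/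
abbrev Prog (c : ToPartrec.Code) : Type :=
  {s : CodeStmt // some s ∈ stmts program (codeSupp c .halt)}

/-- The states of the automaton computing with `c`: it reads a word, appends the final digit and
the separator, moves the result to the main stack, runs `c`, and finally compares the output with
the rest of its input. -/
inductive Ctl (c : ToPartrec.Code) : Type where
  | input
  | pushCons
  | pushOne
  | load
  | loaded (b : Γ')
  | run (t : Prog c) (v : Option Γ')
  | done
  | output
  | dead

namespace Ctl

variable {c : ToPartrec.Code}

instance : Finite (Prog c) :=
  Finite.of_injective (β := stmts program (codeSupp c .halt)) (fun s => ⟨some s.1, s.2⟩) fun s t h => by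
    simpa [Subtype.ext_iff] using h

instance : Finite (Ctl c) :=
  Finite.of_injective (β := (Γ' ⊕ (Prog c × Option Γ')) ⊕ Fin 7)
    (fun
      | .loaded b => .inl (.inl b)
      | .run t v => .inl (.inr (t, v))
      | .input => .inr 0
      | .pushCons => .inr 1
      | .pushOne => .inr 2
      | .load => .inr 3
      | .done => .inr 4
      | .output => .inr 5
      | .dead => .inr 6)
    (by rintro (_ | _ | _ | _ | _ | _ | _ | _ | _) (_ | _ | _ | _ | _ | _ | _ | _ | _) h <;>
          simp at h ⊢ <;> exact h)

open Classical in
/-- The state in which the statement `s` is about to be executed. -/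
noncomputable def enter (s : CodeStmt) (v : Option Γ') : Ctl c :=
  if h : some s ∈ stmts program (codeSupp c .halt) then .run ⟨s, h⟩ v else .dead

theorem enter_eq {s : CodeStmt} (h : some s ∈ stmts program (codeSupp c .halt))
    (v : Option Γ') : enter s v = .run ⟨s, h⟩ v :=
  dif_pos h

/-- The stack inspected in a given state. -/
def inspected : Ctl c → K'
  | .input | .load => .rev
  | .run ⟨.push k _ _, _⟩ _ | .run ⟨.peek k _ _, _⟩ _ | .run ⟨.pop k _ _, _⟩ _ => k
  | _ => .main

def onBit (b : Bool) : Ctl c → Option Γ' → Ctl c × StackAct Γ'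
  | .input, _ => (.input, .push (bitSym b))
  | .done, o | .output, o => if o = some (bitSym b) then (.output, .pop) else (.dead, .keep)
  | _, _ => (.dead, .keep)

noncomputable def onDollar : Ctl c → Option Γ' → Ctl c × StackAct Γ'
  | .input, _ => (.pushCons, .keep)
  | .pushCons, _ => (.pushOne, .push .cons)
  | .pushOne, _ => (.load, .push .bit1)
  | .load, some b => (.loaded b, .pop)
  | .load, none => (enter (program (trNormal c .halt)) none, .keep)
  | .loaded b, _ => (.load, .push b)
  | .run ⟨.push _ f q, _⟩ v, _ => (enter q v, .push (f v))
  | .run ⟨.peek _ f q, _⟩ v, o => (enter q (f v o), .keep)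
  | .run ⟨.pop _ f q, _⟩ v, o => (enter q (f v o), .pop)
  | .run ⟨.load f q, _⟩ v, _ => (enter q (f v), .keep)
  | .run ⟨.branch p q₁ q₂, _⟩ v, _ => (enter (bif p v then q₁ else q₂) v, .keep)
  | .run ⟨.goto l, _⟩ v, _ => (enter (program (l v)) v, .keep)
  | .run ⟨.halt, _⟩ _, _ => (.done, .keep)
  | .done, _ => (.done, .keep)
  | .output, _ | .dead, _ => (.dead, .keep)

theorem enter_cases (s : CodeStmt) (v : Option Γ') :
    (∃ t, enter (c := c) s v = .run t v) ∨ enter (c := c) s v = .dead := by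
  unfold enter
  split
  · exact .inl ⟨_, rfl⟩
  · exact .inr rfl

theorem enter_ne_input (s : CodeStmt) (v : Option Γ') :
    enter (c := c) s v ≠ .input := by
  rcases enter_cases (c := c) s v with ⟨t, h⟩ | h <;> simp [h]

theorem enter_ne_output (s : CodeStmt) (v : Option Γ') :
    enter (c := c) s v ≠ .output := by
  rcases enter_cases (c := c) s v with ⟨t, h⟩ | h <;> simp [h]

theorem onDollar_fst_ne (q : Ctl c) (o : Option Γ') :
    (onDollar q o).1 ≠ .input ∧ (onDollar q o).1 ≠ .output := by
  unfold onDollar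
  split <;> simp [enter_ne_input, enter_ne_output]

theorem onBit_fst_eq_input {b : Bool} {q : Ctl c} {o : Option Γ'}
    (h : (onBit b q o).1 = .input) : q = .input := by
  revert h
  unfold onBit
  split <;> simp <;> split <;> simp

theorem onBit_fst (b : Bool) (q : Ctl c) (o : Option Γ') :
    (onBit b q o).1 = .input ∨ (onBit b q o).1 = .dead ∨
      ((q = .done ∨ q = .output) ∧ o = some (bitSym b) ∧ onBit b q o = (.output, .pop)) := by
  unfold onBit
  split <;> simp <;> split <;> simp_all

end Ctl

open Ctl

noncomputable def codeAut (c : ToPartrec.Code) : StackAut K' Γ' (Ctl c) where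
  κ := inspected
  δ
    | q, .b0 => onBit false q
    | q, .b1 => onBit true q
    | q, .dollar => onDollar q
  start := .input

def bitDSym (b : Bool) : DSym := if b then .b1 else .b0

theorem boolToDSym_cons (b : Bool) (x : List Bool) :
    boolToDSym (b :: x) = bitDSym b :: boolToDSym x := rfl

namespace codeAut

variable (c : ToPartrec.Code)

theorem step_bit (b : Bool) (C : Ctl c × (K' → List Γ')) :
    (codeAut c).step (bitDSym b) C =
      ((onBit b C.1 (C.2 C.1.inspected).head?).1, Function.update C.2 C.1.inspected
        ((onBit b C.1 (C.2 C.1.inspected).head?).2.app (C.2 C.1.inspected))) := by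
  cases b <;> rfl

theorem step_dollar (C : Ctl c × (K' → List Γ')) :
    (codeAut c).step .dollar C =
      ((onDollar C.1 (C.2 C.1.inspected).head?).1, Function.update C.2 C.1.inspected
        ((onDollar C.1 (C.2 C.1.inspected).head?).2.app (C.2 C.1.inspected))) :=
  rfl

theorem eq_bitDSym_or_eq_dollar (d : DSym) : (∃ b, d = bitDSym b) ∨ d = .dollar := by
  cases d
  · exact .inl ⟨false, rfl⟩
  · exact .inl ⟨true, rfl⟩
  · exact .inr rfl

theorem run_replicate (n : ℕ) (s : List DSym) :
    (codeAut c).run (List.replicate n .dollar ++ s) =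
      ((codeAut c).step .dollar)^[n] ((codeAut c).run s) := by
  induction n with
  | zero => rfl
  | succ n ih =>
    rw [Function.iterate_succ_apply', ← ih]
    rfl

theorem run_boolToDSym (x : List Bool) :
    (codeAut c).run (boolToDSym x) =
      (.input, Function.update (fun _ => []) K'.rev (x.map bitSym)) := by
  induction x with
  | nil => simp [boolToDSym, StackAut.run, codeAut]
  | cons b x ih =>
    rw [boolToDSym_cons, StackAut.run, ih, step_bit]
    simp [inspected, onBit, StackAct.app]

/-! ### Reading a matching output -/

theorem run_output (w : List Bool) (s : List DSym) (T : List Γ')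
    (hs : ((codeAut c).run s).1 = .done ∨ ((codeAut c).run s).1 = .output)
    (hT : ((codeAut c).run s).2 .main = (w.map bitSym).reverse ++ T) :
    (((codeAut c).run (boolToDSym w ++ s)).1 = .done ∨
      ((codeAut c).run (boolToDSym w ++ s)).1 = .output) ∧
      ((codeAut c).run (boolToDSym w ++ s)).2 .main = T := by
  induction w generalizing T with
  | nil => exact ⟨hs, hT⟩
  | cons b w ih =>
    obtain ⟨h₁, h₂⟩ := ih (bitSym b :: T) (by simpa using hT)
    rw [boolToDSym_cons, List.cons_append, StackAut.run, step_bit]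
    rcases h₁ with h₁ | h₁ <;> simp [h₁, inspected, h₂, onBit, StackAct.app]

theorem eq_boolToDSym_of_run_eq_input {s : List DSym} (h : ((codeAut c).run s).1 = .input) :
    ∃ x, s = boolToDSym x := by
  induction s with
  | nil => exact ⟨[], rfl⟩
  | cons d s ih =>
    rw [StackAut.run] at h
    obtain ⟨b, rfl⟩ | rfl := eq_bitDSym_or_eq_dollar d
    · rw [step_bit] at h
      obtain ⟨x, rfl⟩ := ih (onBit_fst_eq_input h)
      exact ⟨b :: x, rfl⟩
    · rw [step_dollar] at h
      exact absurd h (onDollar_fst_ne _ _).1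

theorem eq_replicate_of_run_ne {s : List DSym} (h₁ : ((codeAut c).run s).1 ≠ .output)
    (h₂ : ((codeAut c).run s).1 ≠ .dead) :
    ∃ ℓ x, s = List.replicate ℓ .dollar ++ boolToDSym x := by
  induction s with
  | nil => exact ⟨0, [], rfl⟩
  | cons d s ih =>
    obtain ⟨b, rfl⟩ | rfl := eq_bitDSym_or_eq_dollar d
    · suffices h : ((codeAut c).run (bitDSym b :: s)).1 = .input by
        obtain ⟨x, hx⟩ := eq_boolToDSym_of_run_eq_input c h
        exact ⟨0, x, hx⟩
      rw [StackAut.run, step_bit] at h₁ h₂ ⊢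
      rcases onBit_fst b ((codeAut c).run s).1
        (((codeAut c).run s).2 ((codeAut c).run s).1.inspected).head? with h | h | h
      · exact h
      · exact absurd h h₂
      · exact absurd (congrArg Prod.fst h.2.2) h₁
    · rw [StackAut.run, step_dollar] at h₂
      obtain ⟨ℓ, x, rfl⟩ := ih (fun h => h₂ (by simp only [h, onDollar]))
        (fun h => h₂ (by simp only [h, onDollar]))
      exact ⟨ℓ + 1, x, rfl⟩

theorem exists_of_run_eq_done_or_output {s : List DSym}
    (h : ((codeAut c).run s).1 = .done ∨ ((codeAut c).run s).1 = .output) :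
    ∃ w ℓ x, s = boolToDSym w ++ (List.replicate ℓ .dollar ++ boolToDSym x) ∧
      ((codeAut c).run (List.replicate ℓ .dollar ++ boolToDSym x)).1 = .done ∧
      ((codeAut c).run (List.replicate ℓ .dollar ++ boolToDSym x)).2 .main =
        (w.map bitSym).reverse ++ ((codeAut c).run s).2 .main := by
  induction s with
  | nil => simp [StackAut.run, codeAut] at h
  | cons d s ih =>
    rcases h with h | h
    · obtain ⟨ℓ, x, hs⟩ := eq_replicate_of_run_ne c (s := d :: s) (by simp [h]) (by simp [h])
      exact ⟨[], ℓ, x, hs, hs ▸ h, by rw [← hs]; rfl⟩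
    · rw [StackAut.run] at h ⊢
      obtain ⟨b, rfl⟩ | rfl := eq_bitDSym_or_eq_dollar d
      · rw [step_bit] at h ⊢
        rcases onBit_fst b ((codeAut c).run s).1
          (((codeAut c).run s).2 ((codeAut c).run s).1.inspected).head? with h' | h' | h'
        · simp [h'] at h
        · simp [h'] at h
        · obtain ⟨w, ℓ, x, hs, hd, hm⟩ := ih h'.1
          refine ⟨b :: w, ℓ, x, by rw [hs]; rfl, hd, ?_⟩
          have hκ : ((codeAut c).run s).1.inspected = .main := by
            rcases h'.1 with h | h <;> rw [h] <;> rfl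
          obtain ⟨-, ho, he⟩ := h'
          rw [hκ] at ho
          obtain ⟨t, ht⟩ := List.head?_eq_some_iff.1 ho
          rw [he, hm, hκ, ht]
          simp [StackAct.app]
      · rw [step_dollar] at h
        exact absurd h (onDollar_fst_ne _ _).2

/-! ### Running the program -/

/-- `C'` is reached from `C` by reading dollars. -/
def Reach (C C' : Ctl c × (K' → List Γ')) : Prop :=
  ∃ n, ((codeAut c).step .dollar)^[n] C = C'

variable {c}

theorem Reach.refl (C : Ctl c × (K' → List Γ')) : Reach c C C := ⟨0, rfl⟩

theorem Reach.trans {C₁ C₂ C₃ : Ctl c × (K' → List Γ')} (h₁ : Reach c C₁ C₂)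
    (h₂ : Reach c C₂ C₃) : Reach c C₁ C₃ := by
  obtain ⟨m, rfl⟩ := h₁
  obtain ⟨n, rfl⟩ := h₂
  exact ⟨n + m, Function.iterate_add_apply _ _ _ _⟩

theorem Reach.head {C C' : Ctl c × (K' → List Γ')}
    (h : Reach c ((codeAut c).step .dollar C) C') : Reach c C C' :=
  Reach.trans ⟨1, rfl⟩ h

theorem reach_load (l m : List Γ') :
    Reach c (.load, K'.elim m l [] [])
      (enter (program (trNormal c .halt)) none, K'.elim (l.reverse ++ m) [] [] []) := by
  induction l generalizing m with
  | nil =>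
    refine .head ?_
    rw [step_dollar]
    simpa [inspected, onDollar, StackAct.app] using Reach.refl _
  | cons b l ih =>
    refine .head (.head ?_)
    have := ih (b :: m)
    rw [step_dollar, step_dollar]
    simpa [inspected, onDollar, StackAct.app] using this

theorem reach_start (l : List Γ') :
    Reach c (.input, Function.update (fun _ => []) K'.rev l)
      (enter (program (trNormal c .halt)) none, K'.elim (l.reverse ++ [.bit1, .cons]) [] [] []) := by
  have h : Function.update (fun _ => []) K'.rev l = K'.elim [] l [] [] := by
    funext k; cases k <;> rfl
  rw [h]
  refine .head (.head (.head ?_))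
  have := reach_load (c := c) l [.bit1, .cons]
  rw [step_dollar, step_dollar, step_dollar]
  simpa [inspected, onDollar, StackAct.app] using this

/-- The configuration of the automaton corresponding to a configuration of the program. -/
noncomputable def ofCfg (c : ToPartrec.Code) (C : CodeCfg) : Ctl c × (K' → List Γ') :=
  (C.l.elim .done fun l => enter (program l) C.var, C.stk)

theorem reach_stepAux (q : CodeStmt) (v : Option Γ')
    (S : K' → List Γ') (hq : some q ∈ stmts program (codeSupp c .halt)) :
    Reach c (enter q v, S) (ofCfg c (TM2.stepAux q v S)) := by
  induction q generalizing v S with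
  | push k f q ih | peek k f q ih | pop k f q ih | load f q ih =>
    refine .head ?_
    rw [step_dollar, enter_eq hq]
    have hq' := TM2.stmts_trans (q₁ := q) (by simp [stmts₁, TM2.stmts₁_self]) hq
    simpa [inspected, onDollar, StackAct.app] using ih _ _ hq'
  | branch p q₁ q₂ ih₁ ih₂ =>
    refine .head ?_
    rw [step_dollar, enter_eq hq]
    have hq₁ := TM2.stmts_trans (q₁ := q₁) (by simp [stmts₁, TM2.stmts₁_self]) hq
    have hq₂ := TM2.stmts_trans (q₁ := q₂) (by simp [stmts₁, TM2.stmts₁_self]) hq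
    cases hp : p v
    · simpa [inspected, onDollar, StackAct.app, hp] using ih₂ v S hq₂
    · simpa [inspected, onDollar, StackAct.app, hp] using ih₁ v S hq₁
  | goto l | halt =>
    refine .head ?_
    rw [step_dollar, enter_eq hq]
    simpa [inspected, onDollar, StackAct.app, ofCfg] using Reach.refl _

theorem some_program_mem_stmts {l : Λ'} (hl : l ∈ codeSupp c .halt) :
    some (program l) ∈ stmts program (codeSupp c .halt) := by
  simp only [stmts, Finset.some_mem_insertNone, Finset.mem_biUnion]
  exact ⟨l, hl, TM2.stmts₁_self⟩

theorem program_supports (c : ToPartrec.Code) :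
    @TM2.Supports _ _ _ _ ⟨trNormal c .halt⟩ program (codeSupp c .halt) :=
  tr_supports c .halt

theorem reach_of_reaches {C C' : CodeCfg} (h : StateTransition.Reaches (TM2.step program) C C')
    (hC : C.l ∈ Finset.insertNone (codeSupp c .halt)) : Reach c (ofCfg c C) (ofCfg c C') := by
  let _ : Inhabited Λ' := ⟨trNormal c .halt⟩
  induction h using Relation.ReflTransGen.head_induction_on with
  | refl => exact .refl _
  | @head C D h _ ih =>
    refine .trans ?_ (ih (TM2.step_supports program (program_supports c) h hC))
    obtain ⟨_ | l, v, S⟩ := C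
    · simp at h
    · obtain rfl : TM2.stepAux (program l) v S = D := by simpa using h
      exact reach_stepAux _ v S (some_program_mem_stmts (by simpa using hC))

theorem reach_done {x y : List Bool} (h : [bitsToNat y] ∈ c.eval [bitsToNat x.reverse]) :
    ∃ S : K' → List Γ', S .main = y.map bitSym ++ [.bit1, .cons] ∧
      Reach c (.input, Function.update (fun _ => []) K'.rev (x.map bitSym)) (.done, S) := by
  refine ⟨K'.elim (trList [bitsToNat y]) [] [] [], trList_bitsToNat y, (reach_start _).trans ?_⟩
  have he : halt [bitsToNat y] ∈ StateTransition.eval (TM2.step tr)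
      (init c [bitsToNat x.reverse]) := by
    rw [tr_eval]
    exact (Part.mem_map_iff _).2 ⟨_, h, rfl⟩
  have hr := reach_of_reaches (c := c) (StateTransition.mem_eval.1 he).1
    (Finset.some_mem_insertNone.2 (program_supports c).1)
  have hx : trList [bitsToNat x.reverse] = (x.map bitSym).reverse ++ [.bit1, .cons] := by
    rw [trList_bitsToNat, List.map_reverse]
  rw [← hx]
  exact hr

theorem iterate_done (S : K' → List Γ') (n : ℕ) :
    ((codeAut c).step .dollar)^[n] (.done, S) = (.done, S) := by
  refine Function.iterate_fixed ?_ n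
  simp [step_dollar, onDollar, StackAct.app]

/-- Once the computation has been completed, further dollars have no effect. -/
theorem iterate_eq_of_done {C C' : Ctl c × (K' → List Γ')} {m n : ℕ}
    (hm : ((codeAut c).step .dollar)^[m] C = C') (hC' : C'.1 = .done)
    (hn : (((codeAut c).step .dollar)^[n] C).1 = .done) :
    ((codeAut c).step .dollar)^[n] C = C' := by
  obtain ⟨q, S⟩ := C'
  obtain rfl : q = .done := hC'
  generalize hD : ((codeAut c).step .dollar)^[n] C = D at hn ⊢
  obtain ⟨q, T⟩ := D
  obtain rfl : q = .done := hn
  have h₁ := iterate_done (c := c) S n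
  have h₂ := iterate_done (c := c) T m
  rw [← hm, ← Function.iterate_add_apply] at h₁
  rw [← hD, ← Function.iterate_add_apply, Nat.add_comm, h₁, hm] at h₂
  rw [← hD, ← h₂]

end codeAut

open codeAut

/-- "universality". For every computable
`f : {0,1}* → {0,1}*` there is a computable `g : {0,1}* → ℕ` such that the
language `{ f(x)·$^ℓ·x : x ∈ {0,1}*, ℓ ≥ g(x) }` over `{0,1,$}` is recognised
by some total PEG. -/
theorem peg_universality (f : List Bool → List Bool) (hf : Computable f) :
    ∃ g : List Bool → ℕ, Computable g ∧
      IsPEGLang { s : List DSym | ∃ (x : List Bool) (ℓ : ℕ), g x ≤ ℓ ∧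
        s = boolToDSym (f x) ++ List.replicate ℓ DSym.dollar ++ boolToDSym x } := by
  classical
  obtain ⟨c, hc⟩ := exists_code_bitsToNat hf
  have hrun : ∀ (ℓ : ℕ) (x : List Bool),
      (codeAut c).run (List.replicate ℓ .dollar ++ boolToDSym x) =
        ((codeAut c).step .dollar)^[ℓ]
          (.input, Function.update (fun _ => []) K'.rev (x.map bitSym)) := fun ℓ x => by
    rw [run_replicate, run_boolToDSym]
  have hdone : ∀ x, ∃ n, (((codeAut c).step .dollar)^[n]
      (.input, Function.update (fun _ => []) K'.rev (List.map bitSym x))).1 = .done := fun x => by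
    obtain ⟨S, -, n, hn⟩ := reach_done (hc x)
    exact ⟨n, by rw [hn]⟩
  have hmain : ∀ {x ℓ}, ((codeAut c).run (List.replicate ℓ .dollar ++ boolToDSym x)).1 = .done →
      ((codeAut c).run (List.replicate ℓ .dollar ++ boolToDSym x)).2 .main =
        (f x).reverse.map bitSym ++ [.bit1, .cons] := fun {x ℓ} h => by
    obtain ⟨S, hS, n, hn⟩ := reach_done (hc x)
    rw [hrun] at h ⊢
    rw [iterate_eq_of_done hn rfl h]
    exact hS
  refine ⟨fun x => Nat.find (hdone x),
    (codeAut c).computable_find .dollar .input .done .rev bitSym hdone, ?_⟩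
  have key := (codeAut c).isPEGLang_accepts .done .output .main .bit1 .cons
  convert key using 1
  ext s
  constructor
  · rintro ⟨x, ℓ, hℓ, rfl⟩
    have hd : ((codeAut c).run (List.replicate ℓ .dollar ++ boolToDSym x)).1 = .done := by
      obtain ⟨d, rfl⟩ := Nat.exists_eq_add_of_le' hℓ
      have h := Nat.find_spec (hdone x)
      rw [hrun, Function.iterate_add_apply]
      generalize ((codeAut c).step .dollar)^[Nat.find (hdone x)] _ = C at h ⊢
      obtain ⟨q, S⟩ := C
      obtain rfl : q = .done := h
      rw [iterate_done]
    obtain ⟨h₁, h₂⟩ := run_output c (f x) (List.replicate ℓ .dollar ++ boolToDSym x)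
      [.bit1, .cons] (.inl hd) (by rw [hmain hd, List.map_reverse])
    rw [List.append_assoc]
    exact ⟨h₁, [], h₂⟩
  · rintro ⟨hs, l, hl⟩
    obtain ⟨w, ℓ, x, rfl, hd, hm⟩ := exists_of_run_eq_done_or_output c hs
    rw [hmain hd, hl, ← List.map_reverse] at hm
    obtain rfl := List.reverse_injective (map_bitSym_append_inj hm)
    rw [hrun] at hd
    exact ⟨x, ℓ, Nat.find_min' (hdone x) hd, (List.append_assoc _ _ _).symm⟩
end

section
/- There is no pumping lemma for PEGs: there is a fixed finite alphabet Σ (containing at least the symbols 0, 1, $, #) such that no total computable function A, taking as input an encoding of a total parsing expression grammar G over Σ together with a string over Σ and outputting a string over Σ, has the following property: for every total PEG G over Σ there exists n₀ ∈ ℕ such that for every string x ∈ L(G) with |x| ≥ n₀, the output y = A(G,x) satisfies y ∈ L(G) and |y| > |x|. -/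
/-! For the impossibility of a pumping lemma we fix the four-symbol alphabet
`Fin 4` (its elements representing the symbols `0`, `1`, `$`, `#`), and we
represent (finite-non-terminal) PEGs over it concretely by lists of rules:
the list `l` represents the grammar whose non-terminals are `0, …, l.length-1`
(any out-of-range reference behaving as `FAIL`), with rules given by the list
entries, and starting non-terminal `0`. -/

/-- The rule function of the list-represented grammar `l`. -/
def listRules (l : List (PExp (Fin 4) ℕ)) : ℕ → PExp (Fin 4) ℕ :=
  fun A => l.getD A .fail

/-- Totality of the list-represented grammar `l`. -/
def listTotal (l : List (PExp (Fin 4) ℕ)) : Prop :=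
  ∀ (e : PExp (Fin 4) ℕ) (x : List (Fin 4)), ∃ r, PegRec (listRules l) e x r

/-- The language recognised by the list-represented grammar `l`. -/
def listLang (l : List (PExp (Fin 4) ℕ)) : Set (List (Fin 4)) :=
  { x | PegRec (listRules l) (.nt 0) x (some x) }

/-- An effective encoding of parsing expressions over `Fin 4` by natural numbers. -/
def PExp.code : PExp (Fin 4) ℕ → ℕ
  | .eps => Nat.pair 0 0
  | .fail => Nat.pair 1 0
  | .term a => Nat.pair 2 (a : ℕ)
  | .nt A => Nat.pair 3 A
  | .notP e => Nat.pair 4 e.code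
  | .andP e => Nat.pair 5 e.code
  | .seq e₁ e₂ => Nat.pair 6 (Nat.pair e₁.code e₂.code)
  | .choice e₁ e₂ => Nat.pair 7 (Nat.pair e₁.code e₂.code)

/-- An effective encoding of list-represented grammars by natural numbers. -/
def grammarCode (l : List (PExp (Fin 4) ℕ)) : ℕ :=
  Encodable.encode (l.map PExp.code)

namespace NoPumping

open Turing

/-! ### Computable functions on Turing machines with few symbols -/

section TuringMachine

/-- The starting configuration whose tape holds `h₀` followed by `k` copies of `b`. -/
def initCfg {Γ Λ : Type} [Inhabited Γ] [Inhabited Λ] (h₀ b : Γ) (k : ℕ) : TM0.Cfg Γ Λ :=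
  ⟨default, Tape.mk₁ (h₀ :: List.replicate k b)⟩

theorem lt_two_pow_length_trPosNum (p : PosNum) :
    (p : ℕ) < 2 ^ (PartrecToTM2.trPosNum p).length := by
  induction p with
  | one => simp [PartrecToTM2.trPosNum]
  | bit0 p ih => simp [PartrecToTM2.trPosNum, pow_succ]; omega
  | bit1 p ih => simp [PartrecToTM2.trPosNum, pow_succ]; omega

theorem lt_two_pow_length_trNat (n : ℕ) : n < 2 ^ (PartrecToTM2.trNat n).length := by
  have h : ((n : Num) : ℕ) = n := Num.to_of_nat n
  rw [PartrecToTM2.trNat]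
  rcases hn : (n : Num) with _ | p
  · rw [hn] at h
    rw [← h]
    exact Nat.two_pow_pos _
  · rw [hn] at h
    rw [← h]
    exact lt_two_pow_length_trPosNum p

theorem exists_trNat_eq_replicate (k : ℕ) :
    ∃ n, k ≤ n ∧ PartrecToTM2.trNat n = List.replicate k PartrecToTM2.Γ'.bit1 := by
  rcases k with _ | k
  · exact ⟨0, le_rfl, PartrecToTM2.trNat_zero⟩
  have key : ∃ p : PosNum, k + 1 ≤ (p : ℕ) ∧
      PartrecToTM2.trPosNum p = List.replicate (k + 1) PartrecToTM2.Γ'.bit1 := by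
    induction k with
    | zero => exact ⟨.one, by simp, rfl⟩
    | succ k ih =>
      obtain ⟨p, hp, hp'⟩ := ih
      refine ⟨.bit1 p, ?_, ?_⟩
      · rw [PosNum.cast_bit1]; omega
      · rw [PartrecToTM2.trPosNum, hp', List.replicate_succ (n := k + 1)]
  obtain ⟨p, hp, hp'⟩ := key
  refine ⟨p, hp, ?_⟩
  rw [PartrecToTM2.trNat, ← Num.cast_pos, Num.of_to_nat, PartrecToTM2.trNum, hp']

instance : Fintype PartrecToTM2.K' :=
  ⟨{.main, .rev, .aux, .stack}, fun x => by cases x <;> decide⟩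

/-- A Turing machine supported on a finite set of states can be restricted to that set. -/
theorem exists_finite_machine {Γ Λ : Type} [Inhabited Γ] [Inhabited Λ] (M : TM0.Machine Γ Λ)
    (S : Finset Λ) (hS : TM0.Supports M ↑S) :
    ∃ (Λ' : Type) (_ : Inhabited Λ') (_ : Finite Λ') (M' : TM0.Machine Γ Λ'),
      ∀ (l : List Γ) (o : ListBlank Γ), o ∈ TM0.eval M l → o ∈ TM0.eval M' l := by
  classical
  let g₂ : S → Λ := Subtype.val
  let g₁ : @PointedMap Λ S _ ⟨⟨default, hS.1⟩⟩ :=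
    @PointedMap.mk Λ S _ ⟨⟨default, hS.1⟩⟩
      (fun q => if h : q ∈ S then ⟨q, h⟩ else ⟨default, hS.1⟩) (by simp [default])
  let _ : Inhabited S := ⟨⟨default, hS.1⟩⟩
  let f : PointedMap Γ Γ := ⟨id, rfl⟩
  have hg : ∀ q ∈ (S : Set Λ), g₂ (g₁ q) = q := by
    intro q hq
    have : q ∈ S := hq
    change (if h : q ∈ S then (⟨q, h⟩ : S) else ⟨default, hS.1⟩).1 = q
    rw [dif_pos this]
  refine ⟨S, inferInstance, inferInstance, TM0.Machine.map M f f g₁ g₂, fun l o ho => ?_⟩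
  obtain ⟨c, hc, rfl⟩ := (Part.mem_map_iff _).1 ho
  have hinit : TM0.Cfg.map f g₁ (TM0.init l : TM0.Cfg Γ Λ) = TM0.init l := by
    have := TM0.map_init f g₁ l
    rw [this]
    congr 1
    exact List.map_id l
  obtain ⟨c', ⟨-, rfl⟩, hc'⟩ := StateTransition.tr_eval
    (TM0.Machine.map_respects M f f g₁ g₂ hS (fun _ => rfl) hg)
    (a₁ := TM0.init l) ⟨hS.1, hinit⟩ hc
  refine (Part.mem_map_iff _).2 ⟨_, hc', ?_⟩
  have : ∀ T : Tape Γ, T.map f = T := by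
    rintro ⟨h, L, R⟩
    have hf : ∀ L : ListBlank Γ, L.map f = L := by
      intro L
      refine L.induction_on fun l => ?_
      rw [ListBlank.map_mk]
      congr 1
      exact List.map_id l
    simp only [Tape.map, hf]
    rfl
  rcases c with ⟨q, T⟩
  change (T.map f).right₀ = T.right₀
  rw [this]

theorem trInit_eq {K : Type} [DecidableEq K] {Γ : K → Type} {k : K} {L : List (Γ k)} {a b : Γ k}
    {n : ℕ} (h : L.reverse = a :: List.replicate n b) :
    TM2to1.trInit k L = ((true, Function.update (fun _ => none) k (some a)) : TM2to1.Γ' K Γ) ::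
      List.replicate n ((false, Function.update (fun _ => none) k (some b)) : TM2to1.Γ' K Γ) := by
  rw [TM2to1.trInit, h]
  exact congrArg (List.cons _) List.map_replicate

theorem exists_machine_of_computable {F : ℕ → ℕ} (hF : Computable F) (hmono : Monotone F) :
    ∃ (Γ Λ : Type) (_ : Inhabited Γ) (_ : Inhabited Λ) (_ : Finite Γ) (_ : Finite Λ)
      (M : TM0.Machine Γ Λ) (h₀ b : Γ), ∀ k, ∃ c ∈ StateTransition.eval (TM0.step M)
        (initCfg h₀ b k), ∃ j : ℕ, F k ≤ j ∧ c.Tape.nth j ≠ default := by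
  classical
  have hG : Computable fun n => 2 ^ F n := by
    have : Primrec fun n : ℕ => 2 ^ n :=
      (Primrec₂.unpaired'.1 Nat.Primrec.pow).comp (Primrec.const 2) Primrec.id
    exact this.to_comp.comp hF
  obtain ⟨code, hcode⟩ := ToPartrec.Code.exists_code (Nat.Partrec'.part_iff₁.2 hG)
  let iΛ : Inhabited PartrecToTM2.Λ' := ⟨PartrecToTM2.trNormal code .halt⟩
  have hsupp := TM1to0.tr_supports _
    (TM2to1.tr_supports _ (PartrecToTM2.tr_supports code .halt))
  obtain ⟨Λ', _, _, M', hM'⟩ := exists_finite_machine _ _ hsupp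
  refine ⟨_, Λ', inferInstance, inferInstance, inferInstance, inferInstance, M',
    (true, Function.update (fun _ => none) .main (some .cons)),
    (false, Function.update (fun _ => none) .main (some .bit1)), fun k => ?_⟩
  obtain ⟨n, hkn, hn⟩ := exists_trNat_eq_replicate k
  have h2 : PartrecToTM2.trList [2 ^ F n] ∈
      TM2.eval PartrecToTM2.tr .main (PartrecToTM2.trList [n]) := by
    refine (Part.mem_map_iff _).2 ⟨PartrecToTM2.halt [2 ^ F n], ?_, rfl⟩
    have := PartrecToTM2.tr_eval code [n]
    have hc := hcode ⟨[n], rfl⟩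
    rw [show code.eval [n] = _ from hc] at this
    have hi : (TM2.init .main (PartrecToTM2.trList [n]) : PartrecToTM2.Cfg') =
        PartrecToTM2.init code [n] := by
      simp only [TM2.init, PartrecToTM2.init]
      congr 1
      funext x
      cases x <;> rfl
    have h3 : StateTransition.eval (TM2.step PartrecToTM2.tr)
      (TM2.init .main (PartrecToTM2.trList [n])) = _ := (congrArg _ hi).trans this
    rw [h3]
    simp only [List.Vector.head, PFun.coe_val, Part.map_eq_map, Part.map_some]
    exact Part.mem_some _
  have hdom := (TM2to1.tr_eval_dom PartrecToTM2.tr .main (PartrecToTM2.trList [n])).2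
    (Part.dom_iff_mem.2 ⟨_, h2⟩)
  obtain ⟨o, ho⟩ := Part.dom_iff_mem.1 hdom
  obtain ⟨S, L', rfl, hS, hSm⟩ := TM2to1.tr_eval _ _ _ ho h2
  rw [← TM1to0.tr_eval] at ho
  obtain ⟨c, hc, hco⟩ := (Part.mem_map_iff _).1 (hM' _ _ ho)
  refine ⟨c, ?_, (PartrecToTM2.trNat (2 ^ F n)).length, ?_, fun hd => ?_⟩
  · have hrev : (PartrecToTM2.trList [n]).reverse =
        .cons :: List.replicate k PartrecToTM2.Γ'.bit1 := by
      simp [PartrecToTM2.trList, hn]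
    rwa [trInit_eq hrev] at hc
  · refine (hmono hkn).trans ((Nat.pow_lt_pow_iff_right (a := 2) (by norm_num)).1 ?_).le
    exact lt_two_pow_length_trNat _
  · rw [← Tape.right₀_nth, hco] at hd
    have := congrArg (fun x => x.2 PartrecToTM2.K'.main) hd
    simp only [TM2to1.addBottom_nth_snd] at this
    rw [TM2to1.stk_nth_val _ (hS _), hSm] at this
    simp [PartrecToTM2.trList, default] at this

end TuringMachine

/-! ### Functional semantics of total grammars -/

section Semantics

variable {α ν : Type} {R : ν → PExp α ν}

theorem exists_eq_append_of_pegRec {e : PExp α ν} {x y : List α} (h : PegRec R e x (some y)) :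
    ∃ z, x = y ++ z := by
  generalize hr : some y = r at h
  induction h generalizing y with
  | eps x | notFail _ x | andSucc _ x => cases hr; exact ⟨x, rfl⟩
  | termOk a z => cases hr; exact ⟨z, rfl⟩
  | seqOk e₁ e₂ y₁ z y₂ _ _ _ ih =>
    cases hr
    obtain ⟨w, rfl⟩ := ih rfl
    exact ⟨w, by simp⟩
  | choice₁ _ _ _ _ _ ih | choice₂ _ _ _ _ _ _ _ ih | ntRule _ _ _ _ ih => exact ih hr
  | _ => cases hr

theorem pegRec_unique {e : PExp α ν} {x : List α} {r r' : Option (List α)}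
    (h : PegRec R e x r) (h' : PegRec R e x r') : r = r' := by
  induction h generalizing r' with
  | eps | fail | termNil => cases h'; rfl
  | termOk | termMismatch => cases h' <;> simp_all
  | notFail _ _ _ ih | notSucc _ _ _ _ ih | andSucc _ _ _ _ ih | andFail _ _ _ ih =>
    cases h' with
    | _ => rename_i h; have := ih h; simp_all
  | seqOk e₁ e₂ y₁ z y₂ _ _ ih₁ ih₂ =>
    generalize hx : y₁ ++ z = x at h'
    cases h' with
    | seqOk _ _ y₁' z' y₂' h₁ h₂ =>
      rw [← hx] at h₁
      cases ih₁ h₁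
      cases List.append_cancel_left hx
      cases ih₂ h₂
      rfl
    | seqFail₁ _ _ _ h₁ => rw [← hx] at h₁; cases ih₁ h₁
    | seqFail₂ _ _ y₁' z' h₁ h₂ =>
      rw [← hx] at h₁
      cases ih₁ h₁
      cases List.append_cancel_left hx
      cases ih₂ h₂
  | seqFail₁ e₁ e₂ x _ ih =>
    cases h' with
    | seqOk _ _ y₁' z' y₂' h₁ h₂ => cases ih h₁
    | _ => rfl
  | seqFail₂ e₁ e₂ y₁ z _ _ ih₁ ih₂ =>
    generalize hx : y₁ ++ z = x at h'
    cases h' with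
    | seqOk _ _ y₁' z' y₂' h₁ h₂ =>
      rw [← hx] at h₁
      cases ih₁ h₁
      cases List.append_cancel_left hx
      cases ih₂ h₂
    | _ => rfl
  | choice₁ _ _ _ _ _ ih =>
    cases h' with
    | choice₁ _ _ _ _ h => exact ih h
    | choice₂ _ _ _ _ h => cases ih h
  | choice₂ _ _ _ _ _ _ ih₁ ih₂ =>
    cases h' with
    | choice₁ _ _ _ _ h => cases ih₁ h
    | choice₂ _ _ _ _ _ h => exact ih₂ h
  | ntRule _ _ _ _ ih =>
    cases h' with
    | ntRule _ _ _ h => exact ih h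

open scoped Classical in
/-- The suffix of the input left over by a successful recognition, and `none` on failure. -/
noncomputable def rest (R : ν → PExp α ν) (e : PExp α ν) (x : List α) : Option (List α) :=
  if h : ∃ r, PegRec R e x r then h.choose.map fun y => x.drop y.length else none

theorem rest_eq {e : PExp α ν} {x : List α} {r : Option (List α)} (h : PegRec R e x r) :
    rest R e x = r.map fun y => x.drop y.length := by
  have h' : ∃ r, PegRec R e x r := ⟨r, h⟩
  rw [rest, dif_pos h', pegRec_unique h'.choose_spec h]

@[simp] theorem rest_eps (x : List α) : rest R .eps x = some x := by
  simp [rest_eq (.eps x)]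

@[simp] theorem rest_fail (x : List α) : rest R .fail x = none := by
  simp [rest_eq (.fail x)]

@[simp] theorem rest_term_nil (a : α) : rest R (.term a) [] = none := by
  simp [rest_eq (.termNil a)]

@[simp] theorem rest_term_self (a : α) (x : List α) : rest R (.term a) (a :: x) = some x := by
  simp [rest_eq (.termOk a x)]

theorem rest_term_ne {a b : α} (h : a ≠ b) (x : List α) : rest R (.term a) (b :: x) = none := by
  simp [rest_eq (.termMismatch a b x h)]

variable (hT : ∀ e x, ∃ r, PegRec R e x r)
include hT

theorem rest_notP (e : PExp α ν) (x : List α) :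
    rest R (.notP e) x = if (rest R e x).isSome then none else some x := by
  obtain ⟨_ | y, h⟩ := hT e x
  · simp [rest_eq h, rest_eq (.notFail e x h)]
  · simp [rest_eq h, rest_eq (.notSucc e x y h)]

theorem rest_andP (e : PExp α ν) (x : List α) :
    rest R (.andP e) x = if (rest R e x).isSome then some x else none := by
  obtain ⟨_ | y, h⟩ := hT e x
  · simp [rest_eq h, rest_eq (.andFail e x h)]
  · simp [rest_eq h, rest_eq (.andSucc e x y h)]

theorem rest_seq (e₁ e₂ : PExp α ν) (x : List α) :
    rest R (.seq e₁ e₂) x = (rest R e₁ x).bind (rest R e₂) := by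
  obtain ⟨_ | y, h⟩ := hT e₁ x
  · simp [rest_eq h, rest_eq (.seqFail₁ e₁ e₂ x h)]
  · obtain ⟨z, rfl⟩ := exists_eq_append_of_pegRec h
    obtain ⟨_ | y₂, h₂⟩ := hT e₂ z
    · simp [rest_eq h, rest_eq h₂, rest_eq (.seqFail₂ e₁ e₂ y z h h₂)]
    · simp [rest_eq h, rest_eq h₂, rest_eq (.seqOk e₁ e₂ y z y₂ h h₂), List.drop_append]

theorem rest_choice (e₁ e₂ : PExp α ν) (x : List α) :
    rest R (.choice e₁ e₂) x = (rest R e₁ x).or (rest R e₂ x) := by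
  obtain ⟨_ | y, h⟩ := hT e₁ x
  · obtain ⟨r, h₂⟩ := hT e₂ x
    simp [rest_eq h, rest_eq h₂, rest_eq (.choice₂ e₁ e₂ x r h h₂)]
  · simp [rest_eq h, rest_eq (.choice₁ e₁ e₂ x y h)]

theorem rest_nt (A : ν) (x : List α) : rest R (.nt A) x = rest R (R A) x := by
  obtain ⟨r, h⟩ := hT (R A) x
  rw [rest_eq h, rest_eq (.ntRule A x r h)]

theorem pegRec_self_iff {e : PExp α ν} {x : List α} :
    PegRec R e x (some x) ↔ rest R e x = some [] := by
  refine ⟨fun h => by simp [rest_eq h], fun h => ?_⟩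
  obtain ⟨_ | y, hy⟩ := hT e x
  · simp [rest_eq hy] at h
  · obtain ⟨z, rfl⟩ := exists_eq_append_of_pegRec hy
    simp [rest_eq hy] at h
    simpa [h] using hy

end Semantics

/-! ### Guarded grammars are total -/

section Guarded

variable {α ν : Type} {R : ν → PExp α ν}

/-- A parsing expression is guarded if it consumes a terminal before it calls a non-terminal. -/
inductive Guarded : PExp α ν → Prop
  | eps : Guarded .eps
  | fail : Guarded .fail
  | term (a : α) : Guarded (.term a)
  | notP {e : PExp α ν} : Guarded e → Guarded (.notP e)
  | choice {e₁ e₂ : PExp α ν} : Guarded e₁ → Guarded e₂ → Guarded (.choice e₁ e₂)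
  | termSeq (a : α) (e : PExp α ν) : Guarded (.seq (.term a) e)

theorem exists_pegRec_term [DecidableEq α] (a : α) (x : List α) :
    ∃ r, PegRec R (.term a) x r := by
  rcases x with _ | ⟨b, x⟩
  · exact ⟨_, .termNil a⟩
  · by_cases h : a = b
    · exact h ▸ ⟨_, .termOk a x⟩
    · exact ⟨_, .termMismatch a b x h⟩

theorem exists_pegRec_notP {e : PExp α ν} {x : List α} (h : ∃ r, PegRec R e x r) :
    ∃ r, PegRec R (.notP e) x r := by
  obtain ⟨_ | y, h⟩ := h
  exacts [⟨_, .notFail _ _ h⟩, ⟨_, .notSucc _ _ _ h⟩]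

theorem exists_pegRec_choice {e₁ e₂ : PExp α ν} {x : List α} (h₁ : ∃ r, PegRec R e₁ x r)
    (h₂ : ∃ r, PegRec R e₂ x r) : ∃ r, PegRec R (.choice e₁ e₂) x r := by
  obtain ⟨_ | y, h⟩ := h₁
  · obtain ⟨r, h'⟩ := h₂
    exact ⟨_, .choice₂ _ _ _ _ h h'⟩
  · exact ⟨_, .choice₁ _ _ _ _ h⟩

theorem exists_pegRec_of_guarded [DecidableEq α] {x : List α}
    (ih : ∀ e z, z.length < x.length → ∃ r, PegRec R e z r) {e : PExp α ν} (he : Guarded e) :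
    ∃ r, PegRec R e x r := by
  induction he with
  | eps => exact ⟨_, .eps x⟩
  | fail => exact ⟨_, .fail x⟩
  | term a => exact exists_pegRec_term a x
  | notP _ h => exact exists_pegRec_notP h
  | choice _ _ h₁ h₂ => exact exists_pegRec_choice h₁ h₂
  | termSeq a e =>
    obtain ⟨_ | y, h⟩ := exists_pegRec_term (R := R) a x
    · exact ⟨_, .seqFail₁ _ _ _ h⟩
    · cases h with
      | termOk a z =>
        obtain ⟨_ | y₂, h'⟩ := ih e z (by simp)
        · exact ⟨_, .seqFail₂ _ _ [a] z (.termOk a z) h'⟩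
        · exact ⟨_, .seqOk _ _ [a] z y₂ (.termOk a z) h'⟩

theorem exists_pegRec [DecidableEq α] (hR : ∀ A, Guarded (R A)) (e : PExp α ν) (x : List α) :
    ∃ r, PegRec R e x r := by
  induction hn : x.length using Nat.strong_induction_on generalizing e x with
  | _ n ih =>
    have hlt : ∀ e z, z.length < x.length → ∃ r, PegRec R e z r :=
      fun e z hz => ih _ (hn ▸ hz) e z rfl
    induction e with
    | eps => exact ⟨_, .eps x⟩
    | fail => exact ⟨_, .fail x⟩
    | term a => exact exists_pegRec_term a x
    | nt A =>
      obtain ⟨r, h⟩ := exists_pegRec_of_guarded hlt (hR A)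
      exact ⟨r, .ntRule _ _ _ h⟩
    | notP e h => exact exists_pegRec_notP h
    | andP e h =>
      obtain ⟨_ | y, h⟩ := h
      exacts [⟨_, .andFail _ _ h⟩, ⟨_, .andSucc _ _ _ h⟩]
    | seq e₁ e₂ h₁ h₂ =>
      obtain ⟨_ | y, h⟩ := h₁
      · exact ⟨_, .seqFail₁ _ _ _ h⟩
      · obtain ⟨z, rfl⟩ := exists_eq_append_of_pegRec h
        have hz : ∃ r, PegRec R e₂ z r := by
          rcases y with _ | ⟨a, y⟩
          · exact h₂
          · exact hlt _ _ (by simp)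
        obtain ⟨_ | y₂, h'⟩ := hz
        · exact ⟨_, .seqFail₂ _ _ y z h h'⟩
        · exact ⟨_, .seqOk _ _ y z y₂ h h'⟩
    | choice e₁ e₂ h₁ h₂ => exact exists_pegRec_choice h₁ h₂

end Guarded

/-! ### A grammar whose suffixes are the configurations of a Turing machine -/

section Simulation

/-- The non-terminals of the grammar simulating a Turing machine. -/
inductive Sym (Λ Γ : Type) : Type
  | start
  | all
  | state (p : Option Λ)
  | head (a : Γ)
  | left
  | right

variable {Λ Γ : Type} [Inhabited Λ] [Inhabited Γ] [Fintype Λ] [Fintype Γ] [DecidableEq Λ]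
  [DecidableEq Γ] (M : TM0.Machine Γ Λ) (h₀ b : Γ) (N : Sym Λ Γ → ℕ)

/-- The expression succeeding without consumption if `p` holds and failing otherwise. -/
def test (p : Prop) [Decidable p] : PExp (Fin 4) ℕ := if p then .eps else .fail

/-- The expression succeeding exactly at the end of the input. -/
def eof : PExp (Fin 4) ℕ :=
  .notP (.choice (.term 0) (.choice (.term 1) (.choice (.term 2) (.term 3))))

/-- Continue with `f p a` for the first state `p` and head symbol `a` recognised at the current
suffix, among those listed in `l`. -/
def dispatchList (f : Option Λ → Γ → PExp (Fin 4) ℕ) : List (Option Λ × Γ) → PExp (Fin 4) ℕ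
  | [] => .fail
  | (p, a) :: l =>
    .choice (.seq (.andP (.nt (N (.state p)))) (.seq (.andP (.nt (N (.head a)))) (f p a)))
      (dispatchList f l)

/-- Continue with `f p a` for the state `p` and head symbol `a` recognised at the current suffix. -/
noncomputable def dispatch (f : Option Λ → Γ → PExp (Fin 4) ℕ) : PExp (Fin 4) ℕ :=
  dispatchList N f Finset.univ.toList

/-- Continue with `fi` before the first configuration, and according to the next instruction of
the machine afterwards. -/
def succCase (fi : PExp (Fin 4) ℕ) (f : Λ → TM0.Stmt Γ → PExp (Fin 4) ℕ) :
    Option Λ → Γ → PExp (Fin 4) ℕ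
  | none, _ => fi
  | some q, a => match M q a with
    | none => .fail
    | some (q', s) => f q' s

/-- Continue with `f q a` at a configuration, and fail before the first configuration. -/
def stateCase (f : Λ → Γ → PExp (Fin 4) ℕ) : Option Λ → Γ → PExp (Fin 4) ℕ
  | none, _ => .fail
  | some q, a => f q a

/-- The instruction-dependent part of the rule for `Sym.head a`. -/
def headStep (a : Γ) : TM0.Stmt Γ → PExp (Fin 4) ℕ
  | .write a' => test (a' = a)
  | .move .left => .seq (.nt (N .left)) (.nt (N (.head a)))
  | .move .right => .seq (.nt (N .right)) (.nt (N (.head a)))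

/-- The instruction-dependent part of the rule for `Sym.left`. -/
def leftStep : TM0.Stmt Γ → PExp (Fin 4) ℕ
  | .write _ => .nt (N .left)
  | .move .left => .seq (.nt (N .left)) (.nt (N .left))
  | .move .right => .eps

/-- The instruction-dependent part of the rule for `Sym.right`. -/
def rightStep : TM0.Stmt Γ → PExp (Fin 4) ℕ
  | .write _ => .nt (N .right)
  | .move .left => .eps
  | .move .right => .seq (.nt (N .right)) (.nt (N .right))

/-- The rules of the grammar simulating the machine `M`. The suffix `3 ^ (t + 1) 1 ^ k` stands for
the configuration after `t` steps on input `k`; at this suffix the expressions `Sym.state` and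
`Sym.head` test the state and the scanned symbol, while `Sym.left` and `Sym.right` move to a suffix
whose scanned cell is the left, respectively right, neighbour of the currently scanned one. -/
noncomputable def rule : Sym Λ Γ → PExp (Fin 4) ℕ
  | .start => .seq (.term 3) (.seq
      (.andP (dispatch N (stateCase fun q a => test ((M q a).isNone = true)))) (.nt (N .all)))
  | .all => .choice (.seq (.term 3) (.nt (N .all)))
      (.choice (.seq (.term 1) (.nt (N .all))) eof)
  | .state none => .choice (.seq (.term 1) (.nt (N (.state none)))) eof
  | .state (some q) => .seq (.term 3)
      (dispatch N (succCase M (test (q = default)) fun q' _ => test (q' = q)))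
  | .head a => .choice
      (.seq (.term 3) (dispatch N (succCase M (test (a = h₀)) fun _ s => headStep N a s)))
      (.choice (.seq (.term 1) (test (a = b))) (if a = default then eof else .fail))
  | .left => .choice
      (.seq (.term 3) (dispatch N (succCase M (.nt (N .left)) fun _ s => leftStep N s)))
      (.choice (.seq (.term 1) (.nt (N .left))) eof)
  | .right => .choice
      (.seq (.term 3) (dispatch N (succCase M .eps fun _ s => rightStep N s)))
      (.choice (.term 1) eof)

theorem guarded_rule (s : Sym Λ Γ) : Guarded (rule M h₀ b N s) := by
  have he : Guarded eof :=
    .notP (.choice (.term 0) (.choice (.term 1) (.choice (.term 2) (.term 3))))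
  rcases s with _ | _ | (_ | q) | a | _ | _
  · exact .termSeq _ _
  · exact .choice (.termSeq _ _) (.choice (.termSeq _ _) he)
  · exact .choice (.termSeq _ _) he
  · exact .termSeq _ _
  · refine .choice (.termSeq _ _) (.choice (.termSeq _ _) ?_)
    split
    exacts [he, .fail]
  · exact .choice (.termSeq _ _) (.choice (.termSeq _ _) he)
  · exact .choice (.termSeq _ _) (.choice (.term _) he)

variable {M h₀ b N} {R : ℕ → PExp (Fin 4) ℕ}

@[simp] theorem rest_test (p : Prop) [Decidable p] (x : List (Fin 4)) :
    rest R (test p) x = if p then some x else none := by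
  unfold test
  split <;> simp

variable (hT : ∀ e x, ∃ r, PegRec R e x r)
include hT

theorem rest_eof_nil : rest R eof [] = some [] := by
  simp [eof, rest_notP hT, rest_choice hT]

theorem rest_eof_cons (a : Fin 4) (x : List (Fin 4)) : rest R eof (a :: x) = none := by
  fin_cases a <;> simp [eof, rest_notP hT, rest_choice hT]

/-- The suffix `z` stands for a configuration with state `p` and scanned symbol `a`. -/
def HeadIs (R : ℕ → PExp (Fin 4) ℕ) (N : Sym Λ Γ → ℕ) (z : List (Fin 4)) (a : Γ) : Prop :=
  ∀ a', (rest R (.nt (N (.head a'))) z).isSome ↔ a' = a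

/-- The suffix `z` has state `p`. -/
def StateIs (R : ℕ → PExp (Fin 4) ℕ) (N : Sym Λ Γ → ℕ) (z : List (Fin 4)) (p : Option Λ) : Prop :=
  ∀ p', (rest R (.nt (N (.state p'))) z).isSome ↔ p' = p

omit [Inhabited Λ] [Inhabited Γ] [Fintype Λ] [Fintype Γ] in
theorem rest_dispatchList {z : List (Fin 4)} {p : Option Λ} {a : Γ} (hp : StateIs R N z p)
    (ha : HeadIs R N z a) (f : Option Λ → Γ → PExp (Fin 4) ℕ) (l : List (Option Λ × Γ)) :
    rest R (dispatchList N f l) z = if (p, a) ∈ l then rest R (f p a) z else none := by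
  induction l with
  | nil => simp [dispatchList]
  | cons pa l ih =>
    obtain ⟨p', a'⟩ := pa
    rw [dispatchList, rest_choice hT, rest_seq hT, rest_andP hT, ih]
    by_cases h₁ : p' = p
    · rw [if_pos ((hp p').2 h₁), Option.bind_some, rest_seq hT, rest_andP hT]
      by_cases h₂ : a' = a
      · rw [if_pos ((ha a').2 h₂), Option.bind_some]
        subst h₁ h₂
        cases rest R (f p' a') z <;> simp
      · rw [if_neg (mt (ha a').1 h₂)]
        simp [Ne.symm h₂]
    · rw [if_neg (mt (hp p').1 h₁)]
      simp [Ne.symm h₁]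

omit [Inhabited Λ] [Inhabited Γ] in
theorem rest_dispatch {z : List (Fin 4)} {p : Option Λ} {a : Γ} (hp : StateIs R N z p)
    (ha : HeadIs R N z a) (f : Option Λ → Γ → PExp (Fin 4) ℕ) :
    rest R (dispatch N f) z = rest R (f p a) z := by
  simp [dispatch, rest_dispatchList hT hp ha]

omit [Inhabited Λ] [Inhabited Γ] [DecidableEq Λ] [DecidableEq Γ] in
theorem exists_of_isSome_dispatch {z : List (Fin 4)} {f : Option Λ → Γ → PExp (Fin 4) ℕ}
    (h : (rest R (dispatch N f) z).isSome) :
    ∃ p a, (rest R (.nt (N (.state p))) z).isSome ∧ (rest R (.nt (N (.head a))) z).isSome ∧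
      (rest R (f p a) z).isSome := by
  unfold dispatch at h
  generalize (Finset.univ : Finset (Option Λ × Γ)).toList = l at h
  induction l with
  | nil => simp [dispatchList] at h
  | cons pa l ih =>
    obtain ⟨p, a⟩ := pa
    rw [dispatchList, rest_choice hT, Option.isSome_or, Bool.or_eq_true] at h
    refine h.elim (fun h => ⟨p, a, ?_⟩) ih
    rw [rest_seq hT, rest_andP hT] at h
    split_ifs at h with h₁
    · rw [Option.bind_some, rest_seq hT, rest_andP hT] at h
      split_ifs at h with h₂
      · exact ⟨h₁, h₂, h⟩
      · simp at h
    · simp at h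

/-- Starting at the suffix `z` and moving with the non-terminal `s`, the scanned symbols are
those of `B`. -/
inductive Rep (R : ℕ → PExp (Fin 4) ℕ) (N : Sym Λ Γ → ℕ) (s : Sym Λ Γ) :
    List (Fin 4) → ListBlank Γ → Prop
  | nil : Rep R N s [] (ListBlank.mk [])
  | cons {z z' : List (Fin 4)} {a : Γ} {B : ListBlank Γ} : HeadIs R N z a →
      rest R (.nt (N s)) z = some z' → Rep R N s z' B → Rep R N s z (B.cons a)

/-- The suffix `x` stands for the configuration `c`. -/
structure Sim (R : ℕ → PExp (Fin 4) ℕ) (N : Sym Λ Γ → ℕ) (x : List (Fin 4)) (c : TM0.Cfg Γ Λ) :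
    Prop where
  state : StateIs R N x (some c.q)
  head : HeadIs R N x c.Tape.head
  left : ∃ z, rest R (.nt (N .left)) x = some z ∧ Rep R N .left z c.Tape.left
  right : ∃ z, rest R (.nt (N .right)) x = some z ∧ Rep R N .right z c.Tape.right

variable (hR : ∀ s, R (N s) = rule M h₀ b N s)
include hR

theorem headIs_nil : HeadIs R N [] (default : Γ) := by
  intro a
  rw [rest_nt hT, hR, rule, rest_choice hT, rest_choice hT, rest_seq hT, rest_seq hT]
  by_cases h : a = default <;> simp [h, rest_eof_nil hT]

theorem rest_left_nil : rest R (.nt (N .left)) [] = some [] := by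
  rw [rest_nt hT, hR, rule, rest_choice hT, rest_choice hT, rest_seq hT, rest_seq hT]
  simp [rest_eof_nil hT]

theorem rest_right_nil : rest R (.nt (N .right)) [] = some [] := by
  rw [rest_nt hT, hR, rule, rest_choice hT, rest_choice hT, rest_seq hT]
  simp [rest_eof_nil hT]

theorem Rep.destruct {s : Sym Λ Γ} (hs : rest R (.nt (N s)) [] = some []) {z : List (Fin 4)}
    {B : ListBlank Γ} (h : Rep R N s z B) :
    HeadIs R N z B.head ∧ ∃ z', rest R (.nt (N s)) z = some z' ∧ Rep R N s z' B.tail := by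
  cases h with
  | nil => exact ⟨headIs_nil hT hR, _, hs, .nil⟩
  | cons ha hz hB => simpa using ⟨ha, _, hz, hB⟩

theorem rest_state_cons {x : List (Fin 4)} {p : Option Λ} {a : Γ} (hp : StateIs R N x p)
    (ha : HeadIs R N x a) (q : Λ) : rest R (.nt (N (.state (some q)))) (3 :: x) =
      rest R (succCase M (test (q = default)) (fun q' _ => test (q' = q)) p a) x := by
  rw [rest_nt hT, hR, rule, rest_seq hT, rest_term_self, Option.bind_some,
    rest_dispatch hT hp ha]

theorem rest_state_none_cons (x : List (Fin 4)) :
    rest R (.nt (N (.state none))) (3 :: x) = none := by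
  rw [rest_nt hT, hR, rule, rest_choice hT, rest_seq hT, rest_term_ne (by decide), rest_eof_cons hT]
  rfl

theorem rest_head_cons {x : List (Fin 4)} {p : Option Λ} {a : Γ} (hp : StateIs R N x p)
    (ha : HeadIs R N x a) (a' : Γ) : rest R (.nt (N (.head a'))) (3 :: x) =
      rest R (succCase M (test (a' = h₀)) (fun _ s => headStep N a' s) p a) x := by
  rw [rest_nt hT, hR, rule, rest_choice hT, rest_seq hT, rest_term_self, Option.bind_some,
    rest_dispatch hT hp ha, rest_choice hT, rest_seq hT, rest_term_ne (by decide)]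
  split_ifs <;> simp [rest_eof_cons hT]

theorem rest_left_cons {x : List (Fin 4)} {p : Option Λ} {a : Γ} (hp : StateIs R N x p)
    (ha : HeadIs R N x a) : rest R (.nt (N .left)) (3 :: x) =
      rest R (succCase M (.nt (N .left)) (fun _ s => leftStep N s) p a) x := by
  rw [rest_nt hT, hR, rule, rest_choice hT, rest_seq hT, rest_term_self, Option.bind_some,
    rest_dispatch hT hp ha, rest_choice hT, rest_seq hT, rest_term_ne (by decide),
    rest_eof_cons hT]
  simp

theorem rest_right_cons {x : List (Fin 4)} {p : Option Λ} {a : Γ} (hp : StateIs R N x p)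
    (ha : HeadIs R N x a) : rest R (.nt (N .right)) (3 :: x) =
      rest R (succCase M .eps (fun _ s => rightStep N s) p a) x := by
  rw [rest_nt hT, hR, rule, rest_choice hT, rest_seq hT, rest_term_self, Option.bind_some,
    rest_dispatch hT hp ha, rest_choice hT, rest_term_ne (by decide),
    rest_eof_cons hT]
  simp

theorem isSome_rest_state_none_iff {x : List (Fin 4)} :
    (rest R (.nt (N (.state none))) x).isSome ↔ ∃ k, x = List.replicate k 1 := by
  induction x with
  | nil =>
    rw [rest_nt hT, hR, rule, rest_choice hT, rest_seq hT, rest_eof_nil hT]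
    simp
  | cons a x ih =>
    rw [rest_nt hT, hR, rule, rest_choice hT, rest_seq hT, rest_eof_cons hT, Option.or_none]
    by_cases h : a = 1
    · subst h
      rw [rest_term_self, Option.bind_some, ih]
      constructor
      · rintro ⟨k, rfl⟩
        exact ⟨k + 1, rfl⟩
      · rintro ⟨_ | k, hk⟩
        · cases hk
        · exact ⟨k, by simpa [List.replicate_succ] using hk⟩
    · rw [rest_term_ne (Ne.symm h)]
      simp only [Option.bind_none, Option.isSome_none, Bool.false_eq_true, false_iff]
      rintro ⟨_ | k, hk⟩
      · cases hk
      · exact h (by simpa [List.replicate_succ] using congrArg List.head? hk)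

theorem rest_state_some_replicate (k : ℕ) (q : Λ) :
    rest R (.nt (N (.state (some q)))) (List.replicate k 1) = none := by
  rw [rest_nt hT, hR, rule, rest_seq hT]
  cases k
  · simp
  · rw [List.replicate_succ, rest_term_ne (by decide), Option.bind_none]

theorem stateIs_replicate (k : ℕ) : StateIs R N (List.replicate k 1) (none : Option Λ) := by
  rintro (_ | q)
  · simpa using (isSome_rest_state_none_iff hT hR).2 ⟨k, rfl⟩
  · simp [rest_state_some_replicate hT hR]

theorem headIs_one_cons (x : List (Fin 4)) : HeadIs R N (1 :: x) b := by
  intro a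
  rw [rest_nt hT, hR, rule, rest_choice hT, rest_seq hT, rest_term_ne (by decide),
    rest_choice hT, rest_seq hT, rest_term_self]
  by_cases h : a = b
  · simp [h]
  · split_ifs <;> simp [h, rest_eof_cons hT]

theorem exists_headIs_replicate (k : ℕ) : ∃ a : Γ, HeadIs R N (List.replicate k 1) a := by
  cases k
  exacts [⟨_, headIs_nil hT hR⟩, ⟨_, headIs_one_cons hT hR _⟩]

theorem rest_left_replicate (k : ℕ) :
    rest R (.nt (N .left)) (List.replicate k 1) = some [] := by
  induction k with
  | zero => exact rest_left_nil hT hR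
  | succ k ih =>
    rw [rest_nt hT, hR, rule, rest_choice hT, rest_seq hT, List.replicate_succ,
      rest_term_ne (by decide), rest_choice hT, rest_seq hT, rest_term_self]
    simp [ih]

theorem rest_right_one_cons (x : List (Fin 4)) :
    rest R (.nt (N .right)) (1 :: x) = some x := by
  rw [rest_nt hT, hR, rule, rest_choice hT, rest_seq hT, rest_term_ne (by decide),
    rest_choice hT, rest_term_self]
  simp

theorem rep_right_replicate (k : ℕ) :
    Rep R N .right (List.replicate k 1) (ListBlank.mk (List.replicate k b)) := by
  induction k with
  | zero => exact .nil
  | succ k ih =>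
    rw [List.replicate_succ (a := b), ← ListBlank.cons_mk]
    exact .cons (headIs_one_cons hT hR _) (rest_right_one_cons hT hR _) ih

theorem sim_initCfg (k : ℕ) : Sim R N (3 :: List.replicate k 1) (initCfg (Λ := Λ) h₀ b k) := by
  have hp := stateIs_replicate hT hR k
  obtain ⟨a, ha⟩ := exists_headIs_replicate hT hR k
  refine ⟨?_, ?_, ⟨[], ?_, ?_⟩, ⟨List.replicate k 1, ?_, ?_⟩⟩
  · rintro (_ | q)
    · simp [rest_state_none_cons hT hR]
    · rw [rest_state_cons hT hR hp ha]
      by_cases h : q = default <;> simp [succCase, initCfg, h]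
  · intro a'
    rw [rest_head_cons hT hR hp ha]
    by_cases h : a' = h₀ <;> simp [succCase, initCfg, Tape.mk₁, Tape.mk₂, h]
  · rw [rest_left_cons hT hR hp ha]
    exact rest_left_replicate hT hR k
  · exact .nil
  · rw [rest_right_cons hT hR hp ha]
    simp [succCase]
  · simpa [initCfg, Tape.mk₁, Tape.mk₂] using rep_right_replicate hT hR k

theorem Sim.step {x : List (Fin 4)} {c c' : TM0.Cfg Γ Λ} (h : Sim R N x c)
    (hc : c' ∈ TM0.step M c) : Sim R N (3 :: x) c' := by
  obtain ⟨q, T⟩ := c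
  obtain ⟨hp, ha, ⟨zl, hl, Hl⟩, ⟨zr, hr, Hr⟩⟩ := h
  simp only at hp ha Hl Hr
  simp only [TM0.step, Option.mem_def, Option.map_eq_some_iff] at hc
  obtain ⟨⟨q', s⟩, hM, rfl⟩ := hc
  have hsucc (fi f) : succCase M fi f (some q) T.head = f q' s := by simp [succCase, hM]
  obtain ⟨al, zl', hl', Hl'⟩ := Hl.destruct hT hR (rest_left_nil hT hR)
  obtain ⟨ar, zr', hr', Hr'⟩ := Hr.destruct hT hR (rest_right_nil hT hR)
  refine ⟨?_, ?_, ?_, ?_⟩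
  · rintro (_ | q'')
    · simp [rest_state_none_cons hT hR]
    · rw [rest_state_cons hT hR hp ha, hsucc, rest_test]
      by_cases h : q' = q'' <;> simp [h, eq_comm]
  · intro a'
    rw [rest_head_cons hT hR hp ha, hsucc]
    rcases s with (_ | _) | a
    · simpa [headStep, rest_seq hT, hl, Tape.move] using al a'
    · simpa [headStep, rest_seq hT, hr, Tape.move] using ar a'
    · by_cases h : a' = a
      · simp [headStep, Tape.write, h]
      · simp [headStep, Tape.write, h, Ne.symm h]
  · rw [rest_left_cons hT hR hp ha, hsucc]
    rcases s with (_ | _) | a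
    · simpa [leftStep, rest_seq hT, hl, hl', Tape.move] using Hl'
    · simpa [leftStep, Tape.move] using Rep.cons ha hl Hl
    · simpa [leftStep, Tape.write, hl] using Hl
  · rw [rest_right_cons hT hR hp ha, hsucc]
    rcases s with (_ | _) | a
    · simpa [rightStep, Tape.move] using Rep.cons ha hr Hr
    · simpa [rightStep, rest_seq hT, hr, hr', Tape.move] using Hr'
    · simpa [rightStep, Tape.write, hr] using Hr

omit hT hR [Fintype Λ] [Fintype Γ] [DecidableEq Λ] [DecidableEq Γ] in
/-- The configuration after exactly `t` steps from `c`, if there is one. -/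
def runSteps (M : TM0.Machine Γ Λ) (c : TM0.Cfg Γ Λ) : ℕ → Option (TM0.Cfg Γ Λ)
  | 0 => some c
  | t + 1 => (runSteps M c t).bind (TM0.step M)

theorem sim_runSteps {k t : ℕ} {c : TM0.Cfg Γ Λ} (h : runSteps M (initCfg h₀ b k) t = some c) :
    Sim R N (List.replicate (t + 1) 3 ++ List.replicate k 1) c := by
  induction t generalizing c with
  | zero =>
    cases h
    exact sim_initCfg hT hR k
  | succ t ih =>
    obtain ⟨c', h', hc⟩ := Option.bind_eq_some_iff.1 h
    exact (ih h').step hT hR hc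

theorem exists_sim {x : List (Fin 4)} {q : Λ} (h : (rest R (.nt (N (.state (some q)))) x).isSome) :
    ∃ k t c, x = List.replicate (t + 1) 3 ++ List.replicate k 1 ∧
      runSteps M (initCfg h₀ b k) t = some c ∧ Sim R N x c := by
  induction x generalizing q with
  | nil => simp [rest_nt hT, hR, rule, rest_seq hT] at h
  | cons a x ih =>
    rw [rest_nt hT, hR, rule, rest_seq hT] at h
    by_cases ha : (3 : Fin 4) = a
    swap
    · simp [rest_term_ne ha] at h
    subst ha
    rw [rest_term_self, Option.bind_some] at h
    obtain ⟨_ | q', a, hp, ha, hf⟩ := exists_of_isSome_dispatch hT h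
    · obtain ⟨k, rfl⟩ := (isSome_rest_state_none_iff hT hR).1 hp
      exact ⟨k, 0, _, rfl, rfl, sim_initCfg hT hR k⟩
    · obtain ⟨k, t, c, hx, hc, hs⟩ := ih hp
      cases Option.some_injective _ ((hs.state _).1 hp)
      cases (hs.head _).1 ha
      obtain ⟨q, T⟩ := c
      cases hM : M q T.head with
      | none => simp [succCase, hM] at hf
      | some qs =>
        obtain ⟨c', hc'⟩ : ∃ c', TM0.step M ⟨q, T⟩ = some c' := by
          simp [TM0.step, hM]
        exact ⟨k, t + 1, c', by rw [hx]; rfl, by simp [runSteps, hc, hc'], hs.step hT hR hc'⟩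

theorem rest_all (t k : ℕ) :
    rest R (.nt (N .all)) (List.replicate t 3 ++ List.replicate k 1) = some [] := by
  induction t with
  | zero =>
    rw [List.replicate_zero, List.nil_append]
    induction k with
    | zero =>
      rw [rest_nt hT, hR, rule, rest_choice hT, rest_choice hT, rest_seq hT, rest_seq hT]
      simp [rest_eof_nil hT]
    | succ k ih =>
      rw [rest_nt hT, hR, rule, List.replicate_succ, rest_choice hT, rest_seq hT,
        rest_term_ne (by decide), rest_choice hT, rest_seq hT, rest_term_self]
      simp [ih]
  | succ t ih =>
    rw [rest_nt hT, hR, rule, List.replicate_succ, rest_choice hT, rest_seq hT, List.cons_append,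
      rest_term_self]
    simp [ih]

theorem rest_start_iff {x : List (Fin 4)} : rest R (.nt (N .start)) x = some [] ↔
    ∃ k t c, x = List.replicate (t + 2) 3 ++ List.replicate k 1 ∧
      runSteps M (initCfg h₀ b k) t = some c ∧ TM0.step M c = none := by
  rw [rest_nt hT, hR, rule, rest_seq hT]
  constructor
  · intro h
    rcases x with _ | ⟨a, x⟩
    · simp at h
    by_cases ha : (3 : Fin 4) = a
    swap
    · simp [rest_term_ne ha] at h
    subst ha
    rw [rest_term_self, Option.bind_some, rest_seq hT, rest_andP hT] at h
    split_ifs at h with hd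
    · obtain ⟨_ | q, a, hp, ha, hf⟩ := exists_of_isSome_dispatch hT hd
      · simp [stateCase] at hf
      · obtain ⟨k, t, c, hx, hc, hs⟩ := exists_sim hT hR hp
        cases Option.some_injective _ ((hs.state _).1 hp)
        cases (hs.head _).1 ha
        refine ⟨k, t, c, by rw [hx]; rfl, hc, ?_⟩
        by_contra hne
        simp [stateCase] at hf
        simp [TM0.step, hf] at hne
    · simp at h
  · rintro ⟨k, t, ⟨q, T⟩, rfl, hc, hn⟩
    have hs := sim_runSteps hT hR hc
    have hM : M q T.head = none := by simpa [TM0.step] using hn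
    have hd := rest_dispatch hT hs.state hs.head
      (stateCase fun q a => test ((M q a).isNone = true))
    rw [List.replicate_succ, List.cons_append, rest_term_self, Option.bind_some, rest_seq hT,
      rest_andP hT, hd]
    simp only [stateCase, hM, rest_test, Option.isNone_none, if_true, Option.isSome_some,
      Option.bind_some]
    exact rest_all hT hR _ _

end Simulation

/-! ### Grammars whose words are at least as long as a computable function -/

section Growth

theorem finite_sym (Λ Γ : Type) [Finite Λ] [Finite Γ] : Finite (Sym Λ Γ) := by
  refine Finite.of_surjective (α := Fin 4 ⊕ Option Λ ⊕ Γ) (fun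
    | .inl 0 => .start
    | .inl 1 => .all
    | .inl 2 => .left
    | .inl 3 => .right
    | .inr (.inl p) => .state p
    | .inr (.inr a) => .head a) ?_
  rintro (_ | _ | p | a | _ | _)
  exacts [⟨.inl 0, rfl⟩, ⟨.inl 1, rfl⟩, ⟨.inr (.inl p), rfl⟩, ⟨.inr (.inr a), rfl⟩,
    ⟨.inl 2, rfl⟩, ⟨.inl 3, rfl⟩]

theorem exists_list_rules {Λ Γ : Type} [Finite Λ] [Finite Γ]
    (f : (Sym Λ Γ → ℕ) → Sym Λ Γ → PExp (Fin 4) ℕ) :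
    ∃ (N : Sym Λ Γ → ℕ) (l : List (PExp (Fin 4) ℕ)), N .start = 0 ∧
      (∀ s, listRules l (N s) = f N s) ∧
      ∀ A, (∃ s, listRules l A = f N s) ∨ listRules l A = .fail := by
  have := finite_sym Λ Γ
  obtain ⟨n, ⟨e⟩⟩ := Finite.exists_equiv_fin (Sym Λ Γ)
  have hn : 0 < n := (e .start).pos
  let e' := e.trans (Equiv.swap (e .start) ⟨0, hn⟩)
  let N : Sym Λ Γ → ℕ := fun s => e' s
  have hl (i : Fin n) : listRules (List.ofFn fun i => f N (e'.symm i)) i = f N (e'.symm i) := by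
    simp [listRules]
  refine ⟨N, List.ofFn fun i => f N (e'.symm i), by simp [N, e'], fun s => ?_, fun A => ?_⟩
  · simpa using hl (e' s)
  · by_cases h : A < n
    · exact .inl ⟨_, hl ⟨A, h⟩⟩
    · exact .inr (by simp [listRules, h])

theorem nth_runSteps {Λ Γ : Type} [Inhabited Λ] [Inhabited Γ] {M : TM0.Machine Γ Λ} {h₀ b : Γ}
    {k t : ℕ} {c : TM0.Cfg Γ Λ} (h : runSteps M (initCfg h₀ b k) t = some c) (i : ℤ)
    (hi : (k + t : ℤ) < i) : c.Tape.nth i = default := by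
  induction t generalizing c i with
  | zero =>
    cases h
    lift i to ℕ using by omega
    rw [initCfg, Tape.mk₁, Tape.mk₂, Tape.mk'_nth_nat, ListBlank.nth_mk, List.getI_eq_default]
    simp
    omega
  | succ t ih =>
    obtain ⟨⟨q, T⟩, h', hc⟩ := Option.bind_eq_some_iff.1 h
    push_cast at hi
    simp only [TM0.step, Option.map_eq_some_iff] at hc
    obtain ⟨⟨q', s⟩, -, rfl⟩ := hc
    rcases s with (_ | _) | a
    · simpa using ih h' (i - 1) (by omega)
    · simpa using ih h' (i + 1) (by omega)
    · rw [Tape.write_nth, if_neg (by omega)]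
      exact ih h' i (by omega)

theorem exists_runSteps_of_reaches {Λ Γ : Type} [Inhabited Λ] [Inhabited Γ]
    {M : TM0.Machine Γ Λ} {c c' : TM0.Cfg Γ Λ} (h : StateTransition.Reaches (TM0.step M) c c') :
    ∃ t, runSteps M c t = some c' := by
  induction h with
  | refl => exact ⟨0, rfl⟩
  | tail _ hs ih =>
    obtain ⟨t, ht⟩ := ih
    exact ⟨t + 1, by simpa [runSteps, ht] using hs⟩

theorem runSteps_eq_none_of_lt {Λ Γ : Type} [Inhabited Λ] [Inhabited Γ] {M : TM0.Machine Γ Λ}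
    {c c' : TM0.Cfg Γ Λ} {t t' : ℕ} (h : runSteps M c t = some c') (hs : TM0.step M c' = none)
    (ht : t < t') : runSteps M c t' = none := by
  induction t', ht using Nat.le_induction with
  | base => simp [runSteps, h, hs]
  | succ t' _ ih => simp [runSteps, ih]

theorem exists_grammar_of_computable {F : ℕ → ℕ} (hF : Computable F) (hmono : Monotone F) :
    ∃ (l : List (PExp (Fin 4) ℕ)) (w : ℕ → List (Fin 4)), listTotal l ∧
      listLang l = Set.range w ∧ ∀ k, k ≤ (w k).length ∧ F k ≤ (w k).length := by
  classical
  obtain ⟨Γ, Λ, _, _, _, _, M, h₀, b, hM⟩ := exists_machine_of_computable hF hmono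
  have := Fintype.ofFinite Γ
  have := Fintype.ofFinite Λ
  obtain ⟨N, l, hstart, hR, hl⟩ := exists_list_rules (rule M h₀ b)
  have hT : listTotal l := exists_pegRec fun A => by
    obtain ⟨s, h⟩ | h := hl A
    · exact h ▸ guarded_rule M h₀ b N s
    · exact h ▸ .fail
  have hrun (k : ℕ) : ∃ t c, runSteps M (initCfg h₀ b k) t = some c ∧ TM0.step M c = none ∧
      F k ≤ k + t := by
    obtain ⟨c, hc, j, hj, hne⟩ := hM k
    obtain ⟨hr, hn⟩ := StateTransition.mem_eval.1 hc
    obtain ⟨t, ht⟩ := exists_runSteps_of_reaches hr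
    refine ⟨t, c, ht, hn, hj.trans ?_⟩
    by_contra hlt
    exact hne (nth_runSteps ht j (by omega))
  choose t c hc hn hle using hrun
  refine ⟨l, fun k => List.replicate (t k + 2) 3 ++ List.replicate k 1, hT, ?_, fun k => ?_⟩
  · ext x
    rw [listLang, Set.mem_ofPred_eq, pegRec_self_iff hT, ← hstart, rest_start_iff hT hR]
    constructor
    · rintro ⟨k, t', c', rfl, hc', hn'⟩
      refine ⟨k, ?_⟩
      obtain h | h | h := lt_trichotomy (t k) t'
      · simp [runSteps_eq_none_of_lt (hc k) (hn k) h] at hc'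
      · rw [← h]
      · simpa [runSteps_eq_none_of_lt hc' hn' h] using hc k
    · rintro ⟨k, rfl⟩
      exact ⟨k, t k, c k, rfl, hc k, hn k⟩
  · have := hle k
    simp only [List.length_append, List.length_replicate]
    omega

end Growth

/-! ### Diagonalization -/

section Diagonalization

theorem exists_computable_strict_bound {f : ℕ → ℕ} (hf : Computable f) :
    ∃ G : ℕ → ℕ, Computable G ∧ Monotone G ∧ ∀ m n, m < n → f m < G n := by
  let G : ℕ → ℕ := fun n => Nat.rec 0 (fun m s => s + (f m + 1)) n
  have hstep (n : ℕ) : G (n + 1) = G n + (f n + 1) := rfl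
  have hmono : Monotone G := monotone_nat_of_le_succ fun n => by rw [hstep]; omega
  refine ⟨G, ?_, hmono, fun m n h => ?_⟩
  · refine Computable.nat_rec (f := fun n => n) (g := fun _ => 0)
      (h := fun _ p => p.2 + (f p.1 + 1)) .id (.const 0) ?_
    exact (Primrec.nat_add.to_comp.comp (Computable.snd.comp Computable.snd)
      (Computable.succ.comp (hf.comp (Computable.fst.comp Computable.snd))))
  · have h₁ := hmono (Nat.succ_le_of_lt h)
    have h₂ := hstep m
    simp only [Nat.succ_eq_add_one] at h₁
    omega

theorem pair_mono {a b c d : ℕ} (h₁ : a ≤ b) (h₂ : c ≤ d) : Nat.pair a c ≤ Nat.pair b d := by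
  obtain rfl | h₁ := h₁.eq_or_lt <;> obtain rfl | h₂ := h₂.eq_or_lt
  · rfl
  · exact (Nat.pair_lt_pair_right _ h₂).le
  · exact (Nat.pair_lt_pair_left _ h₁).le
  · exact ((Nat.pair_lt_pair_right _ h₂).trans (Nat.pair_lt_pair_left _ h₁)).le

theorem exists_computable_iterate_bound {A : ℕ → ℕ} (hA : Computable A) :
    ∃ F : ℕ → ℕ, Computable F ∧ Monotone F ∧
      ∀ k c s j, c ≤ k → s ≤ k → j ≤ k → (fun w => A (Nat.pair c w))^[j] s < F k := by
  let X : ℕ → ℕ := fun n =>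
    Nat.rec n.unpair.2.unpair.1 (fun _ w => A (Nat.pair n.unpair.1 w)) n.unpair.2.unpair.2
  have hX (c s j : ℕ) :
      X (Nat.pair c (Nat.pair s j)) = (fun w => A (Nat.pair c w))^[j] s := by
    simp only [X, Nat.unpair_pair]
    induction j with
    | zero => rfl
    | succ j ih => rw [Function.iterate_succ_apply', ← ih]
  have hfst : Computable fun n : ℕ => n.unpair.1 := Computable.fst.comp Computable.unpair
  have hsnd : Computable fun n : ℕ => n.unpair.2 := Computable.snd.comp Computable.unpair
  have hXc : Computable X :=
    Computable.nat_rec (f := fun n : ℕ => n.unpair.2.unpair.2) (g := fun n => n.unpair.2.unpair.1)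
      (h := fun n p => A (Nat.pair n.unpair.1 p.2)) (hsnd.comp hsnd)
      (hfst.comp hsnd) (hA.comp (Primrec₂.natPair.to_comp.comp (hfst.comp Computable.fst)
        (Computable.snd.comp Computable.snd)))
  obtain ⟨G, hG, hmono, hlt⟩ := exists_computable_strict_bound hXc
  refine ⟨fun k => G (Nat.pair k (Nat.pair k k) + 1), ?_, fun a b h => ?_,
    fun k c s j hc hs hj => ?_⟩
  · exact hG.comp (Computable.succ.comp (Primrec₂.natPair.to_comp.comp .id
      (Primrec₂.natPair.to_comp.comp .id .id)))
  · exact hmono (Nat.succ_le_succ (pair_mono h (pair_mono h h)))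
  · rw [← hX]
    exact hlt _ _ (Nat.lt_succ_of_le (pair_mono hc (pair_mono hs hj)))

/-- An injective sequence of naturals takes a value at least `n` among its first `n + 1` terms. -/
theorem exists_le_of_injective {k : ℕ → ℕ} (hk : Function.Injective k) (n : ℕ) :
    ∃ i ≤ n, n ≤ k i := by
  by_contra! h
  obtain ⟨i, -, j, -, hij, he⟩ := Finset.exists_ne_map_eq_of_card_lt_of_maps_to
    (s := Finset.range (n + 1)) (t := Finset.range n) (f := k) (by simp)
    fun i hi => by simpa using h i (by simpa [Nat.lt_succ_iff] using hi)
  exact hij (hk he)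

end Diagonalization

end NoPumping

/-- There is no pumping lemma for PEGs: no total computable
function `A`, taking (an encoding of) a total PEG `G` over the fixed alphabet
`Fin 4` together with a string `x`, has the property that for every total `G`
there is `n₀` such that for all `x ∈ L(G)` with `|x| ≥ n₀`, the output
`y = A(G,x)` is in `L(G)` and is strictly longer than `x`. -/
theorem no_pumping_lemma_for_pegs :
    ¬ ∃ A : List (PExp (Fin 4) ℕ) → List (Fin 4) → List (Fin 4),
      (∃ A' : ℕ → ℕ, Computable A' ∧
        ∀ (l : List (PExp (Fin 4) ℕ)) (x : List (Fin 4)),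
          A' (Nat.pair (grammarCode l) (Encodable.encode x))
            = Encodable.encode (A l x)) ∧
      ∀ l : List (PExp (Fin 4) ℕ), listTotal l →
        ∃ n₀ : ℕ, ∀ x ∈ listLang l, n₀ ≤ x.length →
          A l x ∈ listLang l ∧ x.length < (A l x).length := by
  rintro ⟨A, ⟨A', hA', hAA'⟩, hpump⟩
  obtain ⟨F, hF, hmono, hlt⟩ := NoPumping.exists_computable_iterate_bound hA'
  obtain ⟨l, w, hl, hL, hw⟩ := NoPumping.exists_grammar_of_computable hF hmono
  obtain ⟨n₀, hn₀⟩ := hpump l hl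
  have hmem (i : ℕ) : (A l)^[i] (w n₀) ∈ listLang l ∧ n₀ ≤ ((A l)^[i] (w n₀)).length := by
    induction i with
    | zero => exact ⟨hL ▸ ⟨n₀, rfl⟩, (hw n₀).1⟩
    | succ i ih =>
      obtain ⟨h₁, h₂⟩ := hn₀ _ ih.1 ih.2
      rw [Function.iterate_succ_apply']
      exact ⟨h₁, ih.2.trans h₂.le⟩
  have hlen : StrictMono fun i => ((A l)^[i] (w n₀)).length := strictMono_nat_of_lt_succ fun i => by
    rw [Function.iterate_succ_apply']
    exact (hn₀ _ (hmem i).1 (hmem i).2).2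
  have hcode (i : ℕ) : (fun v => A' (Nat.pair (grammarCode l) v))^[i] (Encodable.encode (w n₀)) =
      Encodable.encode ((A l)^[i] (w n₀)) := by
    induction i with
    | zero => rfl
    | succ i ih => rw [Function.iterate_succ_apply', Function.iterate_succ_apply', ih, hAA']
  have hk (i : ℕ) : ∃ k, w k = (A l)^[i] (w n₀) := by simpa [hL] using (hmem i).1
  choose k hk using hk
  have hinj : Function.Injective k := fun i j h => hlen.injective (by simp only [← hk, h])
  obtain ⟨i, hi, hki⟩ := NoPumping.exists_le_of_injective hinj
    (max (grammarCode l) (Encodable.encode (w n₀)))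
  have h₁ := hlt (k i) _ _ i ((le_max_left _ _).trans hki) ((le_max_right _ _).trans hki)
    (hi.trans hki)
  have h₂ := Encodable.length_le_encode ((A l)^[i] (w n₀))
  have h₃ := (hw (k i)).2
  rw [hcode] at h₁
  rw [hk] at h₃
  omega
end

section
/- There exists a language L over a finite alphabet that is recognised by some total parsing expression grammar, such that for every function t : ℕ → ℕ with t(n) = o(n/(log n)²), neither L nor its reversal Lʳ = { xʳ : x ∈ L } belongs to Online(t(n)). -/
/-! ## Online Turing machines and the equivalence-class counting method -/

/-- A head move of a Turing machine. -/
inductive TMMove : Type where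
  | left : TMMove
  | stay : TMMove
  | right : TMMove

/-- The displacement of a head move. -/
def TMMove.offset : TMMove → ℤ
  | .left => -1
  | .stay => 0
  | .right => 1

/-- The shortest (most-significant-bit-first) binary representation of a
natural number, as a list of booleans; by convention `0` is represented by `"0"`. -/
def natBinRep (n : ℕ) : List Bool :=
  if n = 0 then [false] else (Nat.bits n).reverse

/-- An online (multi-tape) Turing machine with input alphabet `σ`: it has
`tapes + 1` work tapes (tape `0` being the auxiliary tape that initially holds
the input length in binary), and a one-way read-only input tape.  At each step
the transition function sees the current state, the input symbol under the
input head (`none` when past the end of the input) and the symbols under the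
work-tape heads, and produces a new state, a flag telling whether to advance
the input head (thereby reading a new input symbol), and a write/move action
for each work tape. -/
structure OnlineTM (σ : Type) : Type 1 where
  Q : Type
  finQ : Finite Q
  Γ : Type
  finΓ : Finite Γ
  blank : Γ
  sym0 : Γ
  sym1 : Γ
  tapes : ℕ
  q0 : Q
  Halt : Set Q
  F : Set Q
  δ : Q → Option σ → (Fin (tapes + 1) → Γ) →
        Q × Bool × (Fin (tapes + 1) → Γ × TMMove)

/-- A configuration of an online Turing machine. -/
structure OCfg {σ : Type} (M : OnlineTM σ) : Type where
  q : M.Q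
  ipos : ℕ
  hd : Fin (M.tapes + 1) → ℤ
  tape : Fin (M.tapes + 1) → ℤ → M.Γ

/-- The initial configuration on an input of length `n`: initial state, input
head at the start, work tapes blank except the auxiliary tape `0`, which holds
the binary representation of `n` in cells `0, …`. -/
def OnlineTM.initCfg {σ : Type} (M : OnlineTM σ) (n : ℕ) : OCfg M :=
  { q := M.q0
    ipos := 0
    hd := fun _ => 0
    tape := fun i p =>
      if i = 0 ∧ 0 ≤ p ∧ p < (natBinRep n).length then
        (if (natBinRep n).getD p.toNat false then M.sym1 else M.sym0)
      else M.blank }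

open scoped Classical in
/-- A single computation step of an online Turing machine on input `x`
(halting states are absorbing). -/
noncomputable def OnlineTM.stepCfg {σ : Type} (M : OnlineTM σ) (x : List σ)
    (c : OCfg M) : OCfg M :=
  if c.q ∈ M.Halt then c
  else
    let t := M.δ c.q x[c.ipos]? (fun i => c.tape i (c.hd i))
    { q := t.1
      ipos := if t.2.1 then c.ipos + 1 else c.ipos
      hd := fun i => c.hd i + (t.2.2 i).2.offset
      tape := fun i p => if p = c.hd i then (t.2.2 i).1 else c.tape i p }

/-- The configuration of `M` on input `x` after `i` steps. -/
noncomputable def OnlineTM.runCfg {σ : Type} (M : OnlineTM σ) (x : List σ)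
    (i : ℕ) : OCfg M :=
  (M.stepCfg x)^[i] (M.initCfg x.length)

/-- `M` decides `L` doing at most `t(n)` steps of computation per input symbol:
on every input `x` of length `n`, the machine halts after having read the whole
input, it accepts iff `x ∈ L`, and during the computation the input head never
stays put for more than `t(n)` consecutive steps (i.e. at most `t(n)` steps are
performed between consecutive readings of input symbols, before the first
reading and after the last one). -/
def OnlineTM.DecidesIn {σ : Type} (M : OnlineTM σ) (L : Set (List σ))
    (t : ℕ → ℕ) : Prop :=
  ∀ x : List σ, ∃ N : ℕ,
    (M.runCfg x N).q ∈ M.Halt ∧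
    (∀ i < N, (M.runCfg x i).q ∉ M.Halt) ∧
    (M.runCfg x N).ipos = x.length ∧
    ((M.runCfg x N).q ∈ M.F ↔ x ∈ L) ∧
    (∀ i j : ℕ, i ≤ j → j ≤ N →
      (M.runCfg x i).ipos = (M.runCfg x j).ipos → j - i ≤ t x.length)

/-- The class `Online(t(n))` of languages over `σ` decidable by an online
Turing machine doing at most `t(n)` steps of computation per input symbol. -/
def OnlineClass (σ : Type) (t : ℕ → ℕ) : Set (Set (List σ)) :=
  { L | ∃ M : OnlineTM σ, M.DecidesIn L t }

/-- `(L,ℓ,m)`-equivalence (the parameter `ℓ` is implicit in the domain):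
`y₁ ≡ y₂` iff appending any string of length `m` leads to the same
membership in `L`. -/
def LEquiv {σ : Type} (L : Set (List σ)) (m : ℕ) (y₁ y₂ : List σ) : Prop :=
  ∀ x : List σ, x.length = m → (y₁ ++ x ∈ L ↔ y₂ ++ x ∈ L)

/-- `E_L(ℓ,m)`: the number of equivalence classes of strings of length `ℓ`
under `(L,ℓ,m)`-equivalence. -/
noncomputable def numClasses {σ : Type} (L : Set (List σ)) (ℓ m : ℕ) : ℕ :=
  Nat.card (Quot (fun y₁ y₂ : { y : List σ // y.length = ℓ } =>
    LEquiv L m y₁.1 y₂.1))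

/-- `t(n) ∈ o(n/(log n)²)`, i.e. `t(n)·(log n)²/n → 0` as `n → ∞`. -/
def LittleOOfNOverLogSq (t : ℕ → ℕ) : Prop :=
  Filter.Tendsto (fun n : ℕ => (t n : ℝ) * (Real.log n) ^ 2 / n)
    Filter.atTop (nhds 0)

/-! ## Recognition by parsing expressions -/

namespace PegRec

variable {α ν : Type} {R : ν → PExp α ν}

theorem seq_inv {e₁ e₂ : PExp α ν} {x : List α} {r : Option (List α)}
    (h : PegRec R (.seq e₁ e₂) x r) :
    (PegRec R e₁ x none ∧ r = none) ∨
      ∃ y z s, x = y ++ z ∧ PegRec R e₁ x (some y) ∧ PegRec R e₂ z s ∧ r = s.map (y ++ ·) := by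
  cases h with
  | seqOk _ _ y₁ z y₂ h₁ h₂ => exact .inr ⟨y₁, z, some y₂, rfl, h₁, h₂, rfl⟩
  | seqFail₁ _ _ _ h₁ => exact .inl ⟨h₁, rfl⟩
  | seqFail₂ _ _ y₁ z h₁ h₂ => exact .inr ⟨y₁, z, none, rfl, h₁, h₂, rfl⟩

/-- The recognition map is single-valued. -/
theorem deterministic {e : PExp α ν} {x : List α} {r r' : Option (List α)}
    (h : PegRec R e x r) (h' : PegRec R e x r') : r = r' := by
  induction h generalizing r' with
  | eps x => cases h'; rfl
  | fail x => cases h'; rfl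
  | termOk a z =>
    cases h' with
    | termOk => rfl
    | termMismatch _ _ _ h => exact absurd rfl h
  | termMismatch a b z hab =>
    cases h' with
    | termOk => exact absurd rfl hab
    | termMismatch => rfl
  | termNil a => cases h'; rfl
  | notFail e x _ ih =>
    cases h' with
    | notFail => rfl
    | notSucc _ _ _ h => exact absurd (ih h) (by simp)
  | notSucc e x y _ ih =>
    cases h' with
    | notFail _ _ h => exact absurd (ih h) (by simp)
    | notSucc => rfl
  | andSucc e x y _ ih =>
    cases h' with
    | andSucc => rfl
    | andFail _ _ h => exact absurd (ih h) (by simp)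
  | andFail e x _ ih =>
    cases h' with
    | andSucc _ _ _ h => exact absurd (ih h) (by simp)
    | andFail => rfl
  | seqOk e₁ e₂ y₁ z y₂ _ _ ih₁ ih₂ =>
    rcases h'.seq_inv with ⟨h₁, -⟩ | ⟨y, w, s, hx, h₁, h₂, rfl⟩
    · exact absurd (ih₁ h₁) (by simp)
    · obtain rfl : y₁ = y := by simpa using ih₁ h₁
      obtain rfl : z = w := by simpa using hx
      rw [← ih₂ h₂]; rfl
  | seqFail₁ e₁ e₂ x _ ih₁ =>
    rcases h'.seq_inv with ⟨-, rfl⟩ | ⟨y, w, s, hx, h₁, h₂, rfl⟩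
    · rfl
    · exact absurd (ih₁ h₁) (by simp)
  | seqFail₂ e₁ e₂ y₁ z _ _ ih₁ ih₂ =>
    rcases h'.seq_inv with ⟨-, rfl⟩ | ⟨y, w, s, hx, h₁, h₂, rfl⟩
    · rfl
    · obtain rfl : y₁ = y := by simpa using ih₁ h₁
      obtain rfl : z = w := by simpa using hx
      rw [← ih₂ h₂]; rfl
  | choice₁ e₁ e₂ x y _ ih =>
    cases h' with
    | choice₁ _ _ _ _ h => exact ih h
    | choice₂ _ _ _ _ h _ => exact absurd (ih h) (by simp)
  | choice₂ e₁ e₂ x r _ _ ih₁ ih₂ =>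
    cases h' with
    | choice₁ _ _ _ _ h => exact absurd (ih₁ h) (by simp)
    | choice₂ _ _ _ _ _ h => exact ih₂ h
  | ntRule A x r _ ih =>
    cases h' with
    | ntRule _ _ _ h => exact ih h

theorem isPrefix {e : PExp α ν} {x : List α} {r : Option (List α)} (h : PegRec R e x r) :
    ∀ y, r = some y → y <+: x := by
  induction h with
  | termOk a z => rintro _ ⟨⟩; exact ⟨z, rfl⟩
  | eps | notFail | andSucc => rintro _ ⟨⟩; exact List.nil_prefix
  | seqOk e₁ e₂ y₁ z y₂ _ _ _ ih =>
    rintro _ ⟨⟩; exact (List.prefix_append_right_inj y₁).2 (ih y₂ rfl)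
  | choice₁ _ _ _ _ _ ih => exact ih
  | choice₂ _ _ _ _ _ _ _ ih => exact ih
  | ntRule _ _ _ _ ih => exact ih
  | _ => rintro _ ⟨⟩

theorem seq_map {e₁ e₂ : PExp α ν} {y z : List α} {r : Option (List α)}
    (h₁ : PegRec R e₁ (y ++ z) (some y)) (h₂ : PegRec R e₂ z r) :
    PegRec R (.seq e₁ e₂) (y ++ z) (r.map (y ++ ·)) := by
  cases r with
  | none => exact .seqFail₂ _ _ _ _ h₁ h₂
  | some s => exact .seqOk _ _ _ _ _ h₁ h₂

theorem term_seq {e : PExp α ν} {z : List α} {r : Option (List α)} (a : α)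
    (h : PegRec R e z r) : PegRec R (.seq (.term a) e) (a :: z) (r.map (a :: ·)) :=
  seq_map (y := [a]) (.termOk a z) h

theorem term_seq_mismatch {e : PExp α ν} {a b : α} (z : List α) (h : a ≠ b) :
    PegRec R (.seq (.term a) e) (b :: z) none :=
  .seqFail₁ _ _ _ (.termMismatch _ _ _ h)

theorem choice_or {e₁ e₂ : PExp α ν} {x : List α} {r₁ r₂ : Option (List α)}
    (h₁ : PegRec R e₁ x r₁) (h₂ : PegRec R e₂ x r₂) :
    PegRec R (.choice e₁ e₂) x (r₁.or r₂) := by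
  cases r₁ with
  | none => exact .choice₂ _ _ _ _ h₁ h₂
  | some s => exact .choice₁ _ _ _ _ h₁

end PegRec

/-- A parsing expression in which every non-terminal is preceded by a terminal. -/
inductive PExp.Guarded_s17 {α ν : Type} : PExp α ν → Prop where
  | eps : Guarded_s17 .eps
  | fail : Guarded_s17 .fail
  | term (a : α) : Guarded_s17 (.term a)
  | notP {e : PExp α ν} : Guarded_s17 e → Guarded_s17 (.notP e)
  | andP {e : PExp α ν} : Guarded_s17 e → Guarded_s17 (.andP e)
  | termSeq (a : α) (e : PExp α ν) : Guarded_s17 (.seq (.term a) e)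
  | choice {e₁ e₂ : PExp α ν} : Guarded_s17 e₁ → Guarded_s17 e₂ → Guarded_s17 (.choice e₁ e₂)

/-- A terminal has a result on every input. -/
theorem PegRec.exists_term {α ν : Type} (R : ν → PExp α ν) (a : α) (x : List α) :
    ∃ r, PegRec R (.term a) x r := by
  cases x with
  | nil => exact ⟨_, .termNil a⟩
  | cons b z =>
    by_cases h : a = b
    · subst h; exact ⟨_, .termOk a z⟩
    · exact ⟨_, .termMismatch a b z h⟩

theorem PegRec.exists_notP {α ν : Type} {R : ν → PExp α ν} {e : PExp α ν} {x : List α} :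
    (∃ r, PegRec R e x r) → ∃ r, PegRec R (.notP e) x r
  | ⟨none, h⟩ => ⟨_, .notFail _ _ h⟩
  | ⟨some _, h⟩ => ⟨_, .notSucc _ _ _ h⟩

theorem PegRec.exists_andP {α ν : Type} {R : ν → PExp α ν} {e : PExp α ν} {x : List α} :
    (∃ r, PegRec R e x r) → ∃ r, PegRec R (.andP e) x r
  | ⟨none, h⟩ => ⟨_, .andFail _ _ h⟩
  | ⟨some _, h⟩ => ⟨_, .andSucc _ _ _ h⟩

/-- A grammar all of whose rules are guarded is total. -/
theorem PEG.total_of_guarded {α : Type} (G : PEG α) (hG : ∀ A, (G.R A).Guarded_s17) : G.Total := by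
  suffices H : ∀ (n : ℕ) (x : List α), x.length = n → ∀ e : PExp α G.ν, ∃ r, PegRec G.R e x r from
    fun e x => H _ x rfl e
  intro n
  induction n using Nat.strong_induction_on with
  | _ n ih =>
  intro x hx
  have hguard : ∀ e : PExp α G.ν, e.Guarded_s17 → ∃ r, PegRec G.R e x r := by
    intro e he
    induction he with
    | eps => exact ⟨_, .eps x⟩
    | fail => exact ⟨_, .fail x⟩
    | term a => exact PegRec.exists_term _ a x
    | notP _ h => exact PegRec.exists_notP h
    | andP _ h => exact PegRec.exists_andP h
    | termSeq a e =>
      cases x with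
      | nil => exact ⟨_, .seqFail₁ _ _ _ (.termNil a)⟩
      | cons b z =>
        by_cases h : a = b
        · subst h
          obtain ⟨r, hr⟩ := ih z.length (by simp [← hx]) z rfl e
          exact ⟨_, .term_seq a hr⟩
        · exact ⟨_, .term_seq_mismatch z h⟩
    | choice _ _ h₁ h₂ =>
      obtain ⟨r₁, h₁⟩ := h₁
      obtain ⟨r₂, h₂⟩ := h₂
      exact ⟨_, h₁.choice_or h₂⟩
  intro e
  induction e with
  | eps => exact ⟨_, .eps x⟩
  | fail => exact ⟨_, .fail x⟩
  | term a => exact PegRec.exists_term _ a x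
  | nt A => exact (hguard _ (hG A)).imp fun r h => .ntRule A x r h
  | notP e h => exact PegRec.exists_notP h
  | andP e h => exact PegRec.exists_andP h
  | seq e₁ e₂ h₁ h₂ =>
    obtain ⟨r₁, h₁⟩ := h₁
    cases r₁ with
    | none => exact ⟨_, .seqFail₁ _ _ _ h₁⟩
    | some y =>
      obtain ⟨z, rfl⟩ := h₁.isPrefix y rfl
      rcases y with _ | ⟨a, y⟩
      · obtain ⟨r₂, h₂⟩ := h₂
        exact ⟨_, .seq_map (y := []) h₁ h₂⟩
      · obtain ⟨r₂, h₂⟩ := ih z.length (by simp [← hx]) z rfl e₂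
        exact ⟨_, .seq_map h₁ h₂⟩
  | choice e₁ e₂ h₁ h₂ =>
    obtain ⟨r₁, h₁⟩ := h₁
    obtain ⟨r₂, h₂⟩ := h₂
    exact ⟨_, h₁.choice_or h₂⟩

/-! ## A language of queries to binary trees -/

/-- Terminals for binary trees in Polish notation, with bits at the leaves, and for paths. -/
inductive TreeSym : Type where
  | node : TreeSym
  | bit (b : Bool) : TreeSym
  | sep : TreeSym

instance : Finite TreeSym := by
  refine .of_surjective (fun i : Fin 4 => [TreeSym.node, .bit false, .bit true, .sep].get i) ?_
  rintro (_ | (_ | _) | _)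
  exacts [⟨0, rfl⟩, ⟨1, rfl⟩, ⟨2, rfl⟩, ⟨3, rfl⟩]

/-- Non-terminals of the tree query grammar. -/
inductive TreeNT : Type where
  | search : TreeNT
  | skip : TreeNT
  | tree : TreeNT
  | locate : TreeNT

instance : Finite TreeNT := by
  refine .of_surjective (fun i : Fin 4 => [TreeNT.search, .skip, .tree, .locate].get i) ?_
  rintro (_ | _ | _ | _)
  exacts [⟨0, rfl⟩, ⟨1, rfl⟩, ⟨2, rfl⟩, ⟨3, rfl⟩]

open TreeSym TreeNT in
/-- The rules of the tree query grammar. `tree` consumes one tree, and `skip` everything up to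
the next separator. `search`, at a tree followed later by a separator and a leaf-to-root path,
succeeds iff that path leads to a leaf with bit `true`. `locate`, at a leaf-to-root path followed
by a separator and a tree, consumes everything before the subtree at the end of the path. -/
def treeRules : TreeNT → PExp TreeSym TreeNT
  | search =>
    .choice (.seq (.term node) (.seq (.nt search) (.term (bit false))))
      (.choice (.seq (.term node) (.seq (.nt tree) (.seq (.nt search) (.term (bit true)))))
        (.choice (.seq (.term (bit true)) (.nt skip))
          (.seq (.term sep) (.seq (.nt locate) (.seq (.term (bit true)) (.nt skip))))))
  | skip =>
    .choice (.seq (.term node) (.nt skip))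
      (.choice (.seq (.term (bit false)) (.nt skip))
        (.choice (.seq (.term (bit true)) (.nt skip)) (.term sep)))
  | tree =>
    .choice (.seq (.term node) (.seq (.nt tree) (.nt tree)))
      (.choice (.term (bit false)) (.term (bit true)))
  | locate =>
    .choice (.seq (.term (bit false)) (.seq (.nt locate) (.term node)))
      (.choice (.seq (.term (bit true)) (.seq (.nt locate) (.seq (.term node) (.nt tree))))
        (.term sep))

/-- The tree query grammar. -/
def treePEG : PEG TreeSym where
  ν := TreeNT
  finNT := inferInstance
  R := treeRules
  S := .search

theorem treePEG_total : treePEG.Total := by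
  refine treePEG.total_of_guarded fun A => ?_
  cases A <;>
    first
    | exact .choice (.termSeq _ _) (.choice (.termSeq _ _) (.choice (.termSeq _ _) (.termSeq _ _)))
    | exact .choice (.termSeq _ _) (.choice (.termSeq _ _) (.choice (.termSeq _ _) (.term _)))
    | exact .choice (.termSeq _ _) (.choice (.term _) (.term _))
    | exact .choice (.termSeq _ _) (.choice (.termSeq _ _) (.term _))

/-- The complete binary tree of height `k` in Polish notation, whose leaf at the end of the
root-to-leaf path `p` carries the bit `f p`. -/
def treeCode : ℕ → (List Bool → Bool) → List TreeSym
  | 0, f => [.bit (f [])]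
  | k + 1, f => .node :: (treeCode k (fun p => f (false :: p)) ++ treeCode k (fun p => f (true :: p)))

theorem length_treeCode (k : ℕ) (f : List Bool → Bool) : (treeCode k f).length + 1 = 2 ^ (k + 1) := by
  induction k generalizing f with
  | zero => rfl
  | succ k ih =>
    have h₀ := ih fun p => f (false :: p)
    have h₁ := ih fun p => f (true :: p)
    simp only [treeCode, List.length_cons, List.length_append]
    omega

theorem sep_notMem_treeCode (k : ℕ) (f : List Bool → Bool) : TreeSym.sep ∉ treeCode k f := by
  induction k generalizing f with
  | zero => simp [treeCode]
  | succ k ih => simp [treeCode, ih]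

theorem rec_skip {v : List TreeSym} (hv : .sep ∉ v) (s : List TreeSym) :
    PegRec treeRules (.nt .skip) (v ++ .sep :: s) (some (v ++ [.sep])) := by
  induction v with
  | nil =>
    exact .ntRule _ _ _ <| .choice_or (.term_seq_mismatch _ (by simp)) <|
      .choice_or (.term_seq_mismatch _ (by simp)) <|
      .choice_or (.term_seq_mismatch _ (by simp)) (.termOk _ _)
  | cons a v ih =>
    have ih := ih fun h => hv (List.mem_cons_of_mem _ h)
    refine .ntRule _ _ _ ?_
    rcases a with _ | (_ | _) | _
    · exact .choice₁ _ _ _ _ (.term_seq _ ih)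
    · exact .choice₂ _ _ _ _ (.term_seq_mismatch _ (by simp)) <| .choice₁ _ _ _ _ (.term_seq _ ih)
    · exact .choice₂ _ _ _ _ (.term_seq_mismatch _ (by simp)) <|
        .choice₂ _ _ _ _ (.term_seq_mismatch _ (by simp)) <| .choice₁ _ _ _ _ (.term_seq _ ih)
    · simp at hv

theorem rec_tree (k : ℕ) (f : List Bool → Bool) (s : List TreeSym) :
    PegRec treeRules (.nt .tree) (treeCode k f ++ s) (some (treeCode k f)) := by
  induction k generalizing f s with
  | zero =>
    refine .ntRule _ _ _ <| .choice₂ _ _ _ _ (.term_seq_mismatch _ (by simp)) ?_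
    rcases h : f [] with _ | _
    · simpa [treeCode, h] using .choice₁ _ _ _ _ (.termOk _ _)
    · simpa [treeCode, h] using
        .choice₂ _ _ _ _ (.termMismatch _ _ _ (by simp)) (.termOk _ _)
  | succ k ih =>
    refine .ntRule _ _ _ <| .choice₁ _ _ _ _ ?_
    have h := PegRec.seq_map (ih (fun p => f (false :: p)) (treeCode k (fun p => f (true :: p)) ++ s))
      (ih (fun p => f (true :: p)) s)
    simpa [treeCode] using PegRec.term_seq TreeSym.node h

theorem rec_seq_bit {e : PExp TreeSym TreeNT} {U s : List TreeSym} {g b : Bool} (c : Bool)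
    (h : PegRec treeRules e (U ++ .bit b :: s) (if g then some U else none)) :
    PegRec treeRules (.seq e (.term (.bit c))) (U ++ .bit b :: s)
      (if g ∧ b = c then some (U ++ [.bit b]) else none) := by
  cases g with
  | false => simpa using .seqFail₁ _ _ _ (by simpa using h)
  | true =>
    by_cases hbc : b = c
    · subst hbc
      simpa using PegRec.seqOk _ _ _ _ _ (by simpa using h) (.termOk _ s)
    · simpa [hbc] using PegRec.seqFail₂ _ _ _ _ (by simpa using h)
        (.termMismatch (.bit c) (.bit b) s (by simpa using Ne.symm hbc))

theorem rec_search (f : List Bool → Bool) (p : List Bool) {v : List TreeSym} (hv : .sep ∉ v)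
    (s : List TreeSym) :
    PegRec treeRules (.nt .search)
      (treeCode p.length f ++ (v ++ .sep :: (p.reverse.map .bit ++ s)))
      (if f p then some (treeCode p.length f ++ (v ++ .sep :: p.reverse.map .bit)) else none) := by
  induction p generalizing f v s with
  | nil =>
    refine .ntRule _ _ _ <| .choice₂ _ _ _ _ (.term_seq_mismatch _ (by simp)) <|
      .choice₂ _ _ _ _ (.term_seq_mismatch _ (by simp)) ?_
    rcases h : f [] with _ | _
    · simpa [treeCode, h] using PegRec.choice₂ _ _ _ _ (.term_seq_mismatch _ (by simp))
        (.term_seq_mismatch _ (by simp))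
    · simpa [treeCode, h] using PegRec.choice₁ _ _ _ _ (.term_seq _ (rec_skip hv s))
  | cons b p ih =>
    set A := treeCode p.length fun q => f (false :: q) with hA
    set B := treeCode p.length fun q => f (true :: q) with hB
    have hBv : TreeSym.sep ∉ B ++ v := by simp [hv, hB, sep_notMem_treeCode]
    have h₀ := rec_seq_bit (U := A ++ (B ++ v ++ .sep :: p.reverse.map .bit)) (b := b) false
      (by simpa using ih (fun q => f (false :: q)) hBv (.bit b :: s))
    have h₁ := rec_seq_bit (U := B ++ (v ++ .sep :: p.reverse.map .bit)) (b := b) true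
      (by simpa using ih (fun q => f (true :: q)) hv (.bit b :: s))
    have h₁ := PegRec.seq_map (rec_tree p.length (fun q => f (false :: q)) _) h₁
    have key := PegRec.choice_or (PegRec.term_seq TreeSym.node h₀) <|
      PegRec.choice_or (PegRec.term_seq TreeSym.node (by simpa [← hA] using h₁)) <|
      PegRec.choice_or (.term_seq_mismatch (e := .nt .skip) _ (show TreeSym.bit true ≠ _ by simp))
        (.term_seq_mismatch (e := .seq (.nt .locate) (.seq (.term (.bit true)) (.nt .skip))) _
          (show TreeSym.sep ≠ _ by simp))
    have hAB : treeCode (b :: p).length f = .node :: (A ++ B) := rfl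
    rw [hAB]
    refine .ntRule _ _ _ ?_
    convert key using 1
    · rfl
    · simp
    · cases b
      · cases f (false :: p) <;> simp
      · cases f (true :: p) <;> simp

theorem rec_locate (f : List Bool → Bool) (p : List Bool) (j : ℕ) (s : List TreeSym) :
    ∃ y v, .sep ∉ v ∧
      p.reverse.map .bit ++ .sep :: (treeCode (p.length + j) f ++ s) =
        y ++ (treeCode j (fun q => f (p ++ q)) ++ (v ++ s)) ∧
      PegRec treeRules (.nt .locate)
        (p.reverse.map .bit ++ .sep :: (treeCode (p.length + j) f ++ s)) (some y) := by
  induction p using List.reverseRecOn generalizing j with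
  | nil =>
    refine ⟨[.sep], [], by simp, by simp, .ntRule _ _ _ ?_⟩
    exact .choice₂ _ _ _ _ (.term_seq_mismatch _ (by simp)) <|
      .choice₂ _ _ _ _ (.term_seq_mismatch _ (by simp)) <| .termOk _ _
  | append_singleton p b ih =>
    obtain ⟨y, v, hv, hx, h⟩ := ih (j + 1)
    have hlen : (p ++ [b]).length + j = p.length + (j + 1) := by simp; omega
    rw [hlen]
    rw [hx] at h
    set A := treeCode j fun q => f (p ++ false :: q) with hA
    set B := treeCode j fun q => f (p ++ true :: q) with hB
    have hAB : treeCode (j + 1) (fun q => f (p ++ q)) = .node :: (A ++ B) := rfl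
    rw [hAB] at hx h
    cases b with
    | false =>
      refine ⟨.bit false :: (y ++ [.node]), B ++ v, by simp [hv, hB, sep_notMem_treeCode], ?_, ?_⟩
      · simpa using hx
      · refine .ntRule _ _ _ (.choice₁ _ _ _ _ ?_)
        have hx' : (p ++ [false]).reverse.map .bit ++ .sep :: (treeCode (p.length + (j + 1)) f ++ s) =
            .bit false :: (y ++ (.node :: (A ++ B) ++ (v ++ s))) := by simpa using hx
        rw [hx']
        simpa using PegRec.term_seq (TreeSym.bit false)
          (PegRec.seq_map h (PegRec.termOk TreeSym.node _))
    | true =>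
      refine ⟨.bit true :: (y ++ .node :: A), v, hv, ?_, ?_⟩
      · simpa using hx
      · have hx' : (p ++ [true]).reverse.map .bit ++ .sep :: (treeCode (p.length + (j + 1)) f ++ s) =
            .bit true :: (y ++ (.node :: (A ++ B) ++ (v ++ s))) := by simpa using hx
        rw [hx']
        refine .ntRule _ _ _ <|
          .choice₂ _ _ _ _ (.term_seq_mismatch _ (by simp)) (.choice₁ _ _ _ _ ?_)
        have ht := rec_tree j (fun q => f (p ++ false :: q)) (B ++ (v ++ s))
        have hn : PegRec treeRules (.seq (.term .node) (.nt .tree))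
            (.node :: (A ++ B) ++ (v ++ s)) (some (.node :: A)) := by
          simpa using PegRec.term_seq TreeSym.node ht
        simpa using PegRec.term_seq (TreeSym.bit true) (PegRec.seq_map h hn)

theorem mem_treeLang_of_rec {x : List TreeSym} {b : Bool}
    (h : PegRec treeRules (.nt .search) x (if b then some x else none)) :
    x ∈ treePEG.Lang ↔ b = true := by
  cases b with
  | true => exact iff_of_true h rfl
  | false =>
    refine iff_of_false (fun h' => ?_) (by simp)
    exact absurd (h.deterministic h') (by simp)

theorem tree_query_mem (f : List Bool → Bool) (p : List Bool) :
    treeCode p.length f ++ .sep :: p.reverse.map .bit ∈ treePEG.Lang ↔ f p = true :=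
  mem_treeLang_of_rec (by simpa using rec_search f p (v := []) (by simp) [])

theorem query_tree_mem (f : List Bool → Bool) (p : List Bool) :
    .sep :: (p.reverse.map .bit ++ .sep :: (treeCode p.length f ++ [.sep])) ∈ treePEG.Lang ↔
      f p = true := by
  refine mem_treeLang_of_rec (.ntRule _ _ _ ?_)
  refine .choice₂ _ _ _ _ (.term_seq_mismatch _ (by simp)) <|
    .choice₂ _ _ _ _ (.term_seq_mismatch _ (by simp)) <|
    .choice₂ _ _ _ _ (.term_seq_mismatch _ (by simp)) ?_
  obtain ⟨y, v, hv, hx, h⟩ := rec_locate f p 0 [.sep]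
  simp only [Nat.add_zero, treeCode, List.append_nil] at hx h
  rw [hx] at h ⊢
  cases hf : f p with
  | true =>
    rw [hf] at h
    simpa using PegRec.term_seq TreeSym.sep
      (PegRec.seq_map h (PegRec.term_seq (TreeSym.bit true) (rec_skip hv [])))
  | false =>
    rw [hf] at h
    simpa using PegRec.term_seq TreeSym.sep
      (PegRec.seq_map h (.term_seq_mismatch (a := .bit true) (e := .nt .skip) _ (by simp)))

/-! ## Counting equivalence classes of online machines -/

namespace OnlineTM

variable {σ : Type} {M : OnlineTM σ}

theorem runCfg_succ (x : List σ) (i : ℕ) : M.runCfg x (i + 1) = M.stepCfg x (M.runCfg x i) :=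
  Function.iterate_succ_apply' _ _ _

theorem runCfg_add (x : List σ) (i s : ℕ) :
    M.runCfg x (i + s) = (M.stepCfg x)^[s] (M.runCfg x i) := by
  rw [runCfg, add_comm, Function.iterate_add_apply, runCfg]

theorem ipos_stepCfg (x : List σ) (c : OCfg M) :
    c.ipos ≤ (M.stepCfg x c).ipos ∧ (M.stepCfg x c).ipos ≤ c.ipos + 1 := by
  unfold stepCfg
  split_ifs
  · simp
  · dsimp only
    split_ifs <;> simp

theorem ipos_runCfg_mono (x : List σ) : Monotone fun i => (M.runCfg x i).ipos :=
  monotone_nat_of_le_succ fun i => by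
    rw [runCfg_succ]; exact (ipos_stepCfg x _).1

theorem runCfg_eq_of_halt {x : List σ} {N i : ℕ} (h : (M.runCfg x N).q ∈ M.Halt) (hi : N ≤ i) :
    M.runCfg x i = M.runCfg x N := by
  induction i, hi using Nat.le_induction with
  | base => rfl
  | succ i _ ih => rw [runCfg_succ, ih, stepCfg, if_pos h]

theorem stepCfg_congr {x x' : List σ} {c : OCfg M} (h : x[c.ipos]? = x'[c.ipos]?) :
    M.stepCfg x c = M.stepCfg x' c := by
  simp only [stepCfg, h]

/-- Two configurations agree up to distance `R` from their heads. -/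
def AgreeWithin (R : ℕ) (c c' : OCfg M) : Prop :=
  c.q = c'.q ∧ c.ipos = c'.ipos ∧
    ∀ i, ∀ d : ℤ, |d| ≤ R → c.tape i (c.hd i + d) = c'.tape i (c'.hd i + d)

theorem abs_offset_le (m : TMMove) : |m.offset| ≤ 1 := by
  cases m <;> simp [TMMove.offset]

theorem AgreeWithin.stepCfg {R : ℕ} {c c' : OCfg M} (h : AgreeWithin (R + 1) c c')
    {x x' : List σ} (hx : x[c.ipos]? = x'[c.ipos]?) :
    AgreeWithin R (M.stepCfg x c) (M.stepCfg x' c') := by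
  obtain ⟨hq, hp, ht⟩ := h
  have ht0 : (fun i => c.tape i (c.hd i)) = fun i => c'.tape i (c'.hd i) := by
    funext i
    simpa using ht i 0 (by simp; positivity)
  unfold OnlineTM.stepCfg
  rw [← hq, ← hp, ← ht0, ← hx]
  split_ifs
  · exact ⟨hq, hp, fun i d hd => ht i d (hd.trans (by simp))⟩
  · refine ⟨rfl, rfl, fun i d hd => ?_⟩
    dsimp only
    generalize M.δ c.q x[c.ipos]? (fun i => c.tape i (c.hd i)) = τ
    have habs : |(τ.2.2 i).2.offset + d| ≤ ((R + 1 : ℕ) : ℤ) := by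
      refine (abs_add_le _ _).trans ?_
      have := abs_offset_le (τ.2.2 i).2
      push_cast
      omega
    have := ht i _ habs
    simp only [add_assoc, add_eq_left, this]

theorem AgreeWithin.iterate {R s : ℕ} {c c' : OCfg M} (h : AgreeWithin (R + s) c c')
    {x x' : List σ} (hx : ∀ p, c.ipos ≤ p → x[p]? = x'[p]?) :
    AgreeWithin R ((M.stepCfg x)^[s] c) ((M.stepCfg x')^[s] c') := by
  induction s generalizing c c' with
  | zero => exact h
  | succ s ih =>
    rw [Function.iterate_succ_apply, Function.iterate_succ_apply]
    exact ih (AgreeWithin.stepCfg h (hx _ le_rfl))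
      fun p hp => hx p ((ipos_stepCfg x c).1.trans hp)

theorem runCfg_congr_prefix {y u u' : List σ} (hu : u.length = u'.length) {i : ℕ}
    (hi : ∀ j < i, (M.runCfg (y ++ u) j).ipos < y.length) :
    M.runCfg (y ++ u) i = M.runCfg (y ++ u') i := by
  induction i with
  | zero => simp [runCfg, hu]
  | succ i ih =>
    have h := hi i (Nat.lt_succ_self i)
    rw [runCfg_succ, runCfg_succ, ← ih fun j hj => hi j (hj.trans (Nat.lt_succ_self i))]
    refine stepCfg_congr ?_
    rw [List.getElem?_append_left h, List.getElem?_append_left h]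

/-- The configuration in which a machine has just read a prefix of the input depends only on
that prefix and on the length of the remaining input. -/
theorem exists_cfg_after_prefix [Nonempty σ] {L : Set (List σ)} {t : ℕ → ℕ}
    (hM : M.DecidesIn L t) (y : List σ) (m : ℕ) :
    ∃ c : OCfg M, c.ipos = y.length ∧
      ∀ u : List σ, u.length = m → ∃ i, M.runCfg (y ++ u) i = c := by
  classical
  obtain ⟨a⟩ := ‹Nonempty σ›
  obtain ⟨N, -, -, hN, -⟩ := hM (y ++ List.replicate m a)
  have hex : ∃ i, y.length ≤ (M.runCfg (y ++ List.replicate m a) i).ipos := ⟨N, by simp [hN]⟩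
  have hlt : ∀ j < Nat.find hex, (M.runCfg (y ++ List.replicate m a) j).ipos < y.length :=
    fun j hj => not_le.1 (Nat.find_min hex hj)
  refine ⟨M.runCfg (y ++ List.replicate m a) (Nat.find hex), ?_, fun u hu => ⟨Nat.find hex, ?_⟩⟩
  · refine le_antisymm ?_ (Nat.find_spec hex)
    rcases hi : Nat.find hex with _ | i
    · simp [runCfg, initCfg]
    · rw [runCfg_succ]
      have := (ipos_stepCfg (y ++ List.replicate m a) (M.runCfg (y ++ List.replicate m a) i)).2
      have := hlt i (by omega)
      omega
  · exact (runCfg_congr_prefix (by simp [hu]) hlt).symm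

theorem le_of_bounded_stay {g : ℕ → ℕ} (hg : Monotone g) {N t : ℕ}
    (h : ∀ i j, i ≤ j → j ≤ N → g i = g j → j - i ≤ t) {i m : ℕ} (hm : g N ≤ g i + m) :
    N ≤ i + (m + 1) * (t + 1) := by
  have key : ∀ d, i + d * (t + 1) ≤ N → g i + d ≤ g (i + d * (t + 1)) := by
    intro d
    induction d with
    | zero => simp
    | succ d ih =>
      intro hd
      have hle : i + d * (t + 1) ≤ i + (d + 1) * (t + 1) := by gcongr; omega
      have ih := ih (hle.trans hd)
      have h₁ := hg hle
      have h₂ : g (i + d * (t + 1)) ≠ g (i + (d + 1) * (t + 1)) := fun heq => by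
        have := h _ _ hle hd heq
        rw [add_mul] at this
        omega
      omega
  by_contra! hcon
  have h₁ := key (m + 1) hcon.le
  have h₂ := hg hcon.le
  omega

theorem accepts_iff_of_ipos {L : Set (List σ)} {t : ℕ → ℕ} (hM : M.DecidesIn L t)
    {x : List σ} {i m : ℕ} (hi : x.length ≤ (M.runCfg x i).ipos + m) :
    (M.runCfg x (i + (m + 1) * (t x.length + 1))).q ∈ M.F ↔ x ∈ L := by
  obtain ⟨N, hhalt, -, hpos, hacc, hstay⟩ := hM x
  have hN := le_of_bounded_stay (ipos_runCfg_mono x) hstay (i := i) (m := m) (by simpa [hpos])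
  rw [runCfg_eq_of_halt hhalt hN, hacc]

theorem lEquiv_of_agreeWithin {L : Set (List σ)} {t : ℕ → ℕ} (hM : M.DecidesIn L t)
    {y y' : List σ} {m : ℕ} (hy : y.length = y'.length) {c c' : OCfg M}
    (hc : c.ipos = y.length) (hrun : ∀ u : List σ, u.length = m → ∃ i, M.runCfg (y ++ u) i = c)
    (hrun' : ∀ u : List σ, u.length = m → ∃ i, M.runCfg (y' ++ u) i = c')
    (h : AgreeWithin ((m + 1) * (t (y.length + m) + 1)) c c') : LEquiv L m y y' := by
  intro u hu
  obtain ⟨i, hi⟩ := hrun u hu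
  obtain ⟨i', hi'⟩ := hrun' u hu
  have hlen : (y ++ u).length = y.length + m := by simp [hu]
  have hlen' : (y' ++ u).length = y.length + m := by simp [hu, hy]
  rw [← accepts_iff_of_ipos hM (i := i) (m := m) (by rw [hi, hc, hlen]),
    ← accepts_iff_of_ipos hM (x := y' ++ u) (i := i') (m := m)
      (by rw [hi', ← h.2.1, hc, hlen']),
    hlen, hlen', runCfg_add, runCfg_add, hi, hi']
  rw [(AgreeWithin.iterate (R := 0) (by simpa using h) fun p hp => ?_).1]
  rw [hc] at hp
  rw [List.getElem?_append_right hp, List.getElem?_append_right (hy ▸ hp), hy]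

/-- The number of pairwise inequivalent prefixes an online machine can tell apart is
exponential in the time it has left. -/
theorem card_le_two_pow [Nonempty σ] {L : Set (List σ)} {t : ℕ → ℕ} (hM : M.DecidesIn L t) :
    ∃ C : ℕ, ∀ (ι : Type) [Fintype ι] (ℓ m : ℕ) (y : ι → List σ),
      (∀ i, (y i).length = ℓ) → (∀ i j, LEquiv L m (y i) (y j) → i = j) →
      Fintype.card ι ≤ 2 ^ (C * ((m + 1) * (t (ℓ + m) + 1))) := by
  classical
  have := M.finQ
  have := M.finΓ
  let _ := Fintype.ofFinite M.Q
  let _ := Fintype.ofFinite M.Γ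
  refine ⟨Fintype.card M.Q + 3 * (Fintype.card M.Γ * (M.tapes + 1)), fun ι _ ℓ m y hy hinj => ?_⟩
  set R := (m + 1) * (t (ℓ + m) + 1) with hR
  have hRpos : 1 ≤ R := Nat.succ_le_of_lt (by positivity)
  choose c hc hrun using fun i => exists_cfg_after_prefix hM (y i) m
  let F : ι → M.Q × (Fin (M.tapes + 1) → Fin (2 * R + 1) → M.Γ) := fun i =>
    ((c i).q, fun a d => (c i).tape a ((c i).hd a + ((d : ℤ) - R)))
  have hF : Function.Injective F := by
    intro i j hij
    obtain ⟨hq, htape⟩ := Prod.ext_iff.1 hij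
    refine hinj i j (lEquiv_of_agreeWithin hM ((hy i).trans (hy j).symm) (hc i) (hrun i) (hrun j)
      ⟨hq, by rw [hc, hc, hy, hy], fun a d hd => ?_⟩)
    rw [hy, ← hR, abs_le] at hd
    have := congrFun (congrFun htape a) ⟨(d + R).toNat, by omega⟩
    have hcast : (((d + R).toNat : ℕ) : ℤ) - R = d := by omega
    simpa only [F, hcast] using this
  refine (Fintype.card_le_of_injective F hF).trans ?_
  rw [Fintype.card_prod, Fintype.card_fun, Fintype.card_fun, Fintype.card_fin, Fintype.card_fin]
  calc Fintype.card M.Q * (Fintype.card M.Γ ^ (2 * R + 1)) ^ (M.tapes + 1)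
      ≤ 2 ^ Fintype.card M.Q * ((2 ^ Fintype.card M.Γ) ^ (2 * R + 1)) ^ (M.tapes + 1) := by
        gcongr <;> exact Nat.lt_two_pow_self.le
    _ = 2 ^ (Fintype.card M.Q + Fintype.card M.Γ * (M.tapes + 1) * (2 * R + 1)) := by
        rw [← pow_mul, ← pow_mul, ← pow_add]
        congr 1
        ring
    _ ≤ _ := by
        refine Nat.pow_le_pow_right (by norm_num) ?_
        generalize Fintype.card M.Γ * (M.tapes + 1) = b
        nlinarith [Nat.mul_le_mul_left (Fintype.card M.Q) hRpos, Nat.mul_le_mul_left b hRpos]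

end OnlineTM

/-! ## Growth rates -/

theorem LittleOOfNOverLogSq.eventually_lt {t : ℕ → ℕ} (ht : LittleOOfNOverLogSq t) (C a : ℕ) :
    ∀ᶠ k : ℕ in Filter.atTop, C * ((k + 2) * (t (2 ^ (k + 1) + k + a) + 1)) < 2 ^ k := by
  have hn : Filter.Tendsto (fun k : ℕ => 2 ^ (k + 1) + k + a) Filter.atTop Filter.atTop :=
    Filter.tendsto_atTop_mono (fun k => (Nat.le_add_left k _).trans (Nat.le_add_right _ a)) Filter.tendsto_id
  have hε : (0 : ℝ) < 1 / (32 * (C + 1)) := by positivity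
  have h₁ := (ht.comp hn).eventually_lt_const hε
  have h₂ : ∀ c : ℝ, ∀ᶠ k : ℕ in Filter.atTop, c * k < 2 ^ k := by
    intro c
    have := (isLittleO_coe_const_pow_of_one_lt (R := ℝ) (r := 2) (by norm_num)).bound
      (show (0 : ℝ) < 1 / (|c| + 1) by positivity)
    filter_upwards [this] with k hk
    rw [Real.norm_of_nonneg (by positivity), Real.norm_of_nonneg (by positivity),
      div_mul_eq_mul_div, one_mul, le_div_iff₀ (by positivity)] at hk
    rcases Nat.eq_zero_or_pos k with rfl | hpos
    · simp
    · have : (0 : ℝ) < k := by exact_mod_cast hpos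
      nlinarith [le_abs_self c]
  filter_upwards [h₁, h₂ (6 * C), h₂ 1, h₂ a, Filter.eventually_ge_atTop 2] with k h₁ hC hk ha h2
  have h2' : (2 : ℝ) ≤ k := by exact_mod_cast h2
  simp only [Function.comp_apply] at h₁
  set n := 2 ^ (k + 1) + k + a with hndef
  have hnR : (n : ℝ) = 2 * 2 ^ k + k + a := by rw [hndef]; push_cast; ring
  have hpow : (0 : ℝ) < 2 ^ k := by positivity
  have hak : (a : ℝ) < 2 ^ k := by nlinarith [Nat.cast_nonneg (α := ℝ) a]
  have hn4 : (n : ℝ) ≤ 4 * 2 ^ k := by rw [hnR]; linarith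
  have hnpos : (0 : ℝ) < n := by rw [hnR]; positivity
  have hlog : ((k : ℝ) + 1) / 2 ≤ Real.log n := by
    have hle : (2 : ℝ) ^ (k + 1) ≤ n := by
      rw [hnR, pow_succ]; linarith [Nat.cast_nonneg (α := ℝ) a]
    have := Real.log_le_log (by positivity) hle
    rw [Real.log_pow] at this
    push_cast at this
    nlinarith [Real.log_two_gt_d9]
  rw [div_lt_iff₀ hnpos, one_div, ← div_eq_inv_mul, lt_div_iff₀ (by positivity)] at h₁
  have hsq : ((k : ℝ) + 2) / 4 ≤ Real.log n ^ 2 := by nlinarith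
  have ht0 : (0 : ℝ) ≤ t n := Nat.cast_nonneg _
  have hC0 : (0 : ℝ) ≤ C := Nat.cast_nonneg _
  have hmain : (t n : ℝ) * ((k + 2) / 4) * (32 * (C + 1)) < 4 * 2 ^ k :=
    lt_of_le_of_lt (by gcongr) (h₁.trans_le hn4)
  have htk : (0 : ℝ) ≤ t n * (k + 2) := by positivity
  have hgoal : (C : ℝ) * ((k + 2) * (t n + 1)) < 2 ^ k := by
    have e₁ : (C : ℝ) * (k + 2) ≤ 3 * C * k := by nlinarith
    have e₂ : (C : ℝ) * (t n * (k + 2)) * 2 ≤ 2 ^ k := by nlinarith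
    nlinarith
  exact_mod_cast hgoal

/-- A language separating all Boolean functions on words of length `k`, given by prefixes of
length about `2 ^ (k + 1)`, by means of suffixes of length about `k` is not decidable in time
`o(n / (log n) ^ 2)` per symbol. -/
theorem notMem_onlineClass_of_separates {σ : Type} [Nonempty σ] {L : Set (List σ)}
    {t : ℕ → ℕ} (ht : LittleOOfNOverLogSq t) (a b : ℕ) (hb : b ≤ 1)
    (y : ℕ → (List Bool → Bool) → List σ) (u : List Bool → List σ)
    (hy : ∀ k f, (y k f).length = 2 ^ (k + 1) + a) (hu : ∀ p, (u p).length = p.length + b)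
    (hL : ∀ f p, y p.length f ++ u p ∈ L ↔ f p = true) : L ∉ OnlineClass σ t := by
  classical
  rintro ⟨M, hM⟩
  obtain ⟨C, hC⟩ := OnlineTM.card_le_two_pow hM
  obtain ⟨k, hk⟩ := (ht.eventually_lt C (a + b)).exists
  let ext (g : List.Vector Bool k → Bool) (p : List Bool) : Bool :=
    if h : p.length = k then g ⟨p, h⟩ else false
  have hcard := hC (List.Vector Bool k → Bool) _ (k + b) (fun g => y k (ext g))
    (fun g => hy k _) fun g g' hgg' => by
      funext p
      have h := hgg' (u p.1) (by rw [hu, p.2])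
      have hmem : ∀ f, y k f ++ u p.1 ∈ L ↔ f p.1 = true := fun f => by
        simpa only [p.2] using hL f p.1
      rw [hmem, hmem, ← Bool.eq_iff_iff] at h
      simp only [ext, dif_pos p.2] at h
      exact h
  rw [Fintype.card_fun, card_vector, Fintype.card_bool] at hcard
  have hle := (Nat.pow_le_pow_iff_right (by norm_num)).1 hcard
  have hn : 2 ^ (k + 1) + a + (k + b) = 2 ^ (k + 1) + k + (a + b) := by omega
  rw [hn] at hle
  refine absurd (hle.trans ?_) (not_le.2 hk)
  have : k + b + 1 ≤ k + 2 := by omega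
  gcongr

/-- There is a language `L` over a finite alphabet,
recognised by some total parsing expression grammar, such that for every
`t : ℕ → ℕ` with `t(n) = o(n/(log n)²)`, neither `L` nor its reversal
`Lʳ = { xʳ : x ∈ L }` is in `Online(t(n))`. -/
theorem peg_strongly_not_real_time :
    ∃ (σ : Type) (_ : Fintype σ) (L : Set (List σ)),
      IsPEGLang L ∧
      ∀ t : ℕ → ℕ, LittleOOfNOverLogSq t →
        L ∉ OnlineClass σ t ∧
        { x : List σ | x.reverse ∈ L } ∉ OnlineClass σ t := by
  have : Nonempty TreeSym := ⟨.sep⟩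
  refine ⟨TreeSym, Fintype.ofFinite _, treePEG.Lang, ⟨treePEG, treePEG_total, rfl⟩, fun t ht => ⟨?_, ?_⟩⟩
  · refine notMem_onlineClass_of_separates ht 0 0 (by norm_num)
      (fun k f => treeCode k f ++ [.sep]) (fun p => p.reverse.map .bit) (fun k f => ?_)
      (by simp) (fun f p => ?_)
    · simpa using length_treeCode k f
    · simpa using tree_query_mem f p
  · refine notMem_onlineClass_of_separates ht 1 1 le_rfl
      (fun k f => (.sep :: (treeCode k f ++ [.sep])).reverse)
      (fun p => (.sep :: p.reverse.map .bit).reverse) (fun k f => ?_) (by simp) (fun f p => ?_)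
    · simp [← length_treeCode k f]
    · simpa [List.map_reverse] using query_tree_mem f p
end
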